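/- arXiv:2603.09257 — 6 statements merged into one kernel-verified Lean document; each statement's English description precedes it below -/
import Mathlib

section
/- Let m, u ≥ 1 and N = m + u. Let x_1,…,x_N ∈ ℝ^F with labels y_1,…,y_N ∈ {1,…,K}, K ≥ 2, and suppose {1,…,N} is partitioned into disjoint index sets I_train of size m and I_test of size u. Let φ : ℝ^F → ℝ^D, let f = (f_1,…,f_K) : ℝ^D → ℝ^K, and let γ > 0. Suppose M ≥ 0 satisfies |ρ_f(φ(x_i), y_i) − ρ_f(φ(x_j), y)| ≤ M·‖φ(x_i) − φ(x_j)‖ for every i ∈ I_train, every j ∈ I_test, and every y ∈ {1,…,K}. Then (1/u)·Σ_{j∈I_test} 1[ρ_f(φ(x_j), y_j) ≤ 0] − (1/m)·Σ_{i∈I_train} 1[ρ_f(φ(x_i), y_i) ≤ γ] ≤ (M/γ)·W({φ(x_i)}_{i∈I_train}, {φ(x_j)}_{j∈I_test}). -/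
open scoped BigOperators

attribute [local instance] Classical.propDecidable

/-- Empirical 1-Wasserstein distance between `{z i}_{i ∈ S}` and `{z j}_{j ∈ T}`
with cost function `c`. -/
noncomputable def empW {ι α : Type*} (S T : Finset ι) (z : ι → α) (c : α → α → ℝ) : ℝ :=
  sInf { w : ℝ | ∃ Γ : ι → ι → ℝ,
    (∀ i ∈ S, ∀ j ∈ T, 0 ≤ Γ i j) ∧
    (∀ i ∈ S, ∑ j ∈ T, Γ i j = 1 / (S.card : ℝ)) ∧
    (∀ j ∈ T, ∑ i ∈ S, Γ i j = 1 / (T.card : ℝ)) ∧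
    w = ∑ i ∈ S, ∑ j ∈ T, Γ i j * c (z i) (z j) }

/-- Margin `ρ_f(z, y) = f_y(z) − max_{y' ≠ y} f_{y'}(z)`. -/
noncomputable def margin {K : ℕ} {E : Type*} (f : E → Fin K → ℝ) (z : E) (y : Fin K) : ℝ :=
  f z y - sSup { r : ℝ | ∃ y' : Fin K, y' ≠ y ∧ r = f z y' }

theorem stmt0 {F D K m u : ℕ} (hm : 1 ≤ m) (hu : 1 ≤ u) (hK : 2 ≤ K)
    (x : Fin (m + u) → EuclideanSpace ℝ (Fin F)) (y : Fin (m + u) → Fin K)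
    (Itrain Itest : Finset (Fin (m + u)))
    (hdisj : Disjoint Itrain Itest) (hunion : Itrain ∪ Itest = Finset.univ)
    (hctr : Itrain.card = m) (hcte : Itest.card = u)
    (φ : EuclideanSpace ℝ (Fin F) → EuclideanSpace ℝ (Fin D))
    (f : EuclideanSpace ℝ (Fin D) → Fin K → ℝ)
    (γ : ℝ) (hγ : 0 < γ) (M : ℝ) (hM : 0 ≤ M)
    (hLip : ∀ i ∈ Itrain, ∀ j ∈ Itest, ∀ c : Fin K,
      |margin f (φ (x i)) (y i) - margin f (φ (x j)) c| ≤ M * ‖φ (x i) - φ (x j)‖) :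
    (1 / (u : ℝ)) * ∑ j ∈ Itest, (if margin f (φ (x j)) (y j) ≤ 0 then (1 : ℝ) else 0)
      - (1 / (m : ℝ)) * ∑ i ∈ Itrain, (if margin f (φ (x i)) (y i) ≤ γ then (1 : ℝ) else 0)
    ≤ (M / γ) * empW Itrain Itest (fun i => φ (x i)) (fun a b => ‖a - b‖) := by
  classical
  have hm0 : (0:ℝ) < m := by exact_mod_cast hm
  have hu0 : (0:ℝ) < u := by exact_mod_cast hu
  unfold empW
  set A : Fin (m + u) → ℝ := fun i => if margin f (φ (x i)) (y i) ≤ γ then (1 : ℝ) else 0 with hA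
  set B : Fin (m + u) → ℝ := fun j => if margin f (φ (x j)) (y j) ≤ 0 then (1 : ℝ) else 0 with hB
  set S := { w : ℝ | ∃ Γ : Fin (m + u) → Fin (m + u) → ℝ,
    (∀ i ∈ Itrain, ∀ j ∈ Itest, 0 ≤ Γ i j) ∧
    (∀ i ∈ Itrain, ∑ j ∈ Itest, Γ i j = 1 / (Itrain.card : ℝ)) ∧
    (∀ j ∈ Itest, ∑ i ∈ Itrain, Γ i j = 1 / (Itest.card : ℝ)) ∧
    w = ∑ i ∈ Itrain, ∑ j ∈ Itest, Γ i j * ‖φ (x i) - φ (x j)‖ } with hS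
  have hne : S.Nonempty := by
    refine ⟨_, fun _ _ => 1 / ((m : ℝ) * u), ?_, ?_, ?_, rfl⟩
    · intro i _ j _
      positivity
    · intro i _
      rw [Finset.sum_const, hctr, hcte, nsmul_eq_mul]
      field_simp
    · intro j _
      rw [Finset.sum_const, hctr, hcte, nsmul_eq_mul]
      field_simp
  have hpair : ∀ i ∈ Itrain, ∀ j ∈ Itest,
      B j - A i ≤ (M / γ) * ‖φ (x i) - φ (x j)‖ := by
    intro i hi j hj
    have h := (le_abs_self _).trans (hLip i hi j hj (y j))
    have h0 : 0 ≤ (M / γ) * ‖φ (x i) - φ (x j)‖ := by positivity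
    simp only [hA, hB]
    split_ifs with h1 h2 h2
    · linarith
    · rw [div_mul_eq_mul_div, le_div_iff₀ hγ]
      push Not at h2
      linarith
    · linarith
    · linarith
  have key : ∀ w ∈ S, (1 / (u : ℝ)) * ∑ j ∈ Itest, B j - (1 / (m : ℝ)) * ∑ i ∈ Itrain, A i
      ≤ (M / γ) * w := by
    rintro w ⟨Γ, h0, h1, h2, rfl⟩
    rw [hctr] at h1
    rw [hcte] at h2
    have e1 : (1 / (u : ℝ)) * ∑ j ∈ Itest, B j = ∑ i ∈ Itrain, ∑ j ∈ Itest, Γ i j * B j := by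
      rw [Finset.sum_comm, Finset.mul_sum]
      refine Finset.sum_congr rfl fun j hj => ?_
      rw [← Finset.sum_mul, h2 j hj]
    have e2 : (1 / (m : ℝ)) * ∑ i ∈ Itrain, A i = ∑ i ∈ Itrain, ∑ j ∈ Itest, Γ i j * A i := by
      rw [Finset.mul_sum]
      refine Finset.sum_congr rfl fun i hi => ?_
      rw [← Finset.sum_mul, h1 i hi]
    rw [e1, e2, ← Finset.sum_sub_distrib, Finset.mul_sum]
    refine Finset.sum_le_sum fun i hi => ?_
    rw [← Finset.sum_sub_distrib, Finset.mul_sum]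
    refine Finset.sum_le_sum fun j hj => ?_
    have := mul_le_mul_of_nonneg_left (hpair i hi j hj) (h0 i hi j hj)
    linarith
  have hfin : (1 / (u : ℝ)) * ∑ j ∈ Itest, B j - (1 / (m : ℝ)) * ∑ i ∈ Itrain, A i
      ≤ (M / γ) * sInf S := by
    rcases hM.eq_or_lt with h | h
    · obtain ⟨w, hw⟩ := hne
      have := key w hw
      rw [← h] at this ⊢
      simpa using this
    · have hp : 0 < M / γ := by positivity
      rw [← div_le_iff₀' hp]
      refine le_csInf hne fun w hw => ?_
      rw [div_le_iff₀' hp]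
      exact key w hw
  exact hfin
end

section
/- Let m, u ≥ 1, N = m + u, points x_1,…,x_N ∈ ℝ^F with labels y_1,…,y_N ∈ {1,…,K}, K ≥ 2, φ : ℝ^F → ℝ^D, a nonempty set F of classifiers f = (f_1,…,f_K) : ℝ^D → ℝ^K, γ > 0, and δ ∈ (0,1). For a permutation π of {1,…,N} set I_train^{(π)} := {π(1),…,π(m)}, I_test^{(π)} := {π(m+1),…,π(N)}, and for each class c ∈ {1,…,K} set I_{train,c}^{(π)} := {i ∈ I_train^{(π)} : y_i = c}, I_{test,c}^{(π)} := {i ∈ I_test^{(π)} : y_i = c}, m_c^{(π)} := |I_{train,c}^{(π)}|, and u_c^{(π)} := |I_{test,c}^{(π)}|. Define R_u(f; π) := (1/u)·Σ_{i∈I_test^{(π)}} 1[ρ_f(φ(x_i), y_i) ≤ 0] and R_{m,γ}(f; π) := (1/m)·Σ_{i∈I_train^{(π)}} 1[ρ_f(φ(x_i), y_i) ≤ γ]. For each c and each permutation π let W_c^{(π)} denote the empirical 1-Wasserstein distance between {φ(x_i)}_{i∈I_{train,c}^{(π)}} and {φ(x_i)}_{i∈I_{test,c}^{(π)}}, with the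 convention W_c^{(π)} := 0 if either index set is empty. Suppose that for each c there is M_c ≥ 0 with |ρ_f(φ(x_i), c) − ρ_f(φ(x_j), c)| ≤ M_c·‖φ(x_i) − φ(x_j)‖ for every f ∈ F and all i ≠ j in {1,…,N}. Let β := 1/m + 1/u and ε_δ := sqrt( (m·u·β²)/(2·(m+u−1/2)) · (1 − 1/(2·max(m,u)))^{−1} · ln(1/δ) ). Then, for π drawn uniformly at random from the permutations of {1,…,N}, with probability at least 1 − δ the following holds for every f ∈ F: R_u(f; π) − R_{m,γ}(f; π) ≤ Σ_{c=1}^K (M_c/γ)·E_{π'}[ (m_c^{(π')}/m)·W_c^{(π')} ] + E_{π'}[ Σ_{c=1}^K | u_c^{(π')}/u − m_c^{(π')}/m | ] + ε_δ, where E_{π'} denotes expectation over a uniformly random permutation π' of {1,…,N}. -/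
open scoped BigOperators

attribute [local instance] Classical.propDecidable

/-- Training index set `I_train^{(π)} = {π(1),…,π(m)}`. -/
noncomputable def trainIdx (m u : ℕ) (π : Equiv.Perm (Fin (m + u))) : Finset (Fin (m + u)) :=
  (Finset.univ.filter (fun k : Fin (m + u) => (k : ℕ) < m)).image π

/-- Test index set `I_test^{(π)} = {π(m+1),…,π(m+u)}`. -/
noncomputable def testIdx (m u : ℕ) (π : Equiv.Perm (Fin (m + u))) : Finset (Fin (m + u)) :=
  (Finset.univ.filter (fun k : Fin (m + u) => m ≤ (k : ℕ))).image π

/-- Test zero-one error `R_u(f; π)`. -/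
noncomputable def testErr {D K m u : ℕ} (ζ : Fin (m + u) → EuclideanSpace ℝ (Fin D))
    (y : Fin (m + u) → Fin K) (f : EuclideanSpace ℝ (Fin D) → Fin K → ℝ)
    (π : Equiv.Perm (Fin (m + u))) : ℝ :=
  (1 / (u : ℝ)) * ∑ i ∈ testIdx m u π, (if margin f (ζ i) (y i) ≤ 0 then (1 : ℝ) else 0)

/-- Training `γ`-margin error `R_{m,γ}(f; π)`. -/
noncomputable def trainErr {D K m u : ℕ} (ζ : Fin (m + u) → EuclideanSpace ℝ (Fin D))
    (y : Fin (m + u) → Fin K) (f : EuclideanSpace ℝ (Fin D) → Fin K → ℝ) (γ : ℝ)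
    (π : Equiv.Perm (Fin (m + u))) : ℝ :=
  (1 / (m : ℝ)) * ∑ i ∈ trainIdx m u π, (if margin f (ζ i) (y i) ≤ γ then (1 : ℝ) else 0)

/-- Class-wise empirical Wasserstein distance `W_c^{(π)}`, with the convention that it is `0`
when either class-restricted index set is empty. -/
noncomputable def Wclass {D K m u : ℕ} (ζ : Fin (m + u) → EuclideanSpace ℝ (Fin D))
    (y : Fin (m + u) → Fin K) (c : Fin K) (π : Equiv.Perm (Fin (m + u))) : ℝ :=
  if ((trainIdx m u π).filter (fun i => y i = c)).Nonempty ∧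
      ((testIdx m u π).filter (fun i => y i = c)).Nonempty then
    empW ((trainIdx m u π).filter (fun i => y i = c))
      ((testIdx m u π).filter (fun i => y i = c)) ζ (fun a b => ‖a - b‖)
  else 0

/-- Expectation of `g` over a uniformly random permutation. -/
noncomputable def pexp {N : ℕ} (g : Equiv.Perm (Fin N) → ℝ) : ℝ :=
  (∑ π : Equiv.Perm (Fin N), g π) / (Fintype.card (Equiv.Perm (Fin N)) : ℝ)


lemma hoeff_aux {α : Type*} (A : Finset α) (hA : A.Nonempty) (h : α → ℝ) (r : ℝ)
    (hr : ∀ a ∈ A, ∀ b ∈ A, h a - h b ≤ r) (l : ℝ) :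
    (∑ a ∈ A, Real.exp (l * (h a - (∑ b ∈ A, h b) / (A.card : ℝ)))) / (A.card : ℝ)
      ≤ Real.exp (l ^ 2 / 8 * r ^ 2) := by
  let : MeasurableSpace {a // a ∈ A} := ⊤
  have : Nonempty {a // a ∈ A} := hA.to_subtype
  have : MeasurableSingletonClass {a // a ∈ A} := ⟨fun _ => trivial⟩
  set μ : MeasureTheory.Measure {a // a ∈ A} := (PMF.uniformOfFintype {a // a ∈ A}).toMeasure
    with hμ
  have : MeasureTheory.IsProbabilityMeasure μ := PMF.toMeasure.isProbabilityMeasure _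
  have hint : ∀ g : α → ℝ, ∫ a : {a // a ∈ A}, g a ∂μ = (∑ b ∈ A, g b) / (A.card : ℝ) := by
    intro g
    rw [hμ, PMF.integral_eq_sum]
    simp only [PMF.uniformOfFintype_apply, smul_eq_mul, Fintype.card_coe, ENNReal.toReal_inv,
      ENNReal.toReal_natCast]
    rw [← Finset.mul_sum, div_eq_inv_mul, ← Finset.sum_coe_sort A]
  obtain ⟨a0, ha0, hmin⟩ := Finset.exists_min_image A h hA
  have hr0 : 0 ≤ r := by simpa using hr a0 ha0 a0 ha0
  have hs := ProbabilityTheory.hasSubgaussianMGF_of_mem_Icc (μ := μ)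
    (X := fun a : {a // a ∈ A} => h a) (a := h a0) (b := h a0 + r)
    (measurable_from_top.aemeasurable)
    (Filter.Eventually.of_forall fun a => ⟨hmin a a.2, by linarith [hr a a.2 a0 ha0]⟩)
  have hle := hs.mgf_le l
  rw [ProbabilityTheory.mgf] at hle
  simp only [hint] at hle
  rw [hint (fun a => Real.exp (l * (h a - (∑ b ∈ A, h b) / (A.card : ℝ))))] at hle
  refine hle.trans (le_of_eq ?_)
  congr 1
  simp [abs_of_nonneg hr0]
  ring

/-- average over m-subsets -/
noncomputable def sAvg {α : Type*} (m : ℕ) (A : Finset α) (g : Finset α → ℝ) : ℝ :=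
  (∑ S ∈ A.powersetCard m, g S) / (A.card.choose m : ℝ)

lemma double_count {α : Type*} (m : ℕ) (A : Finset α) (g : Finset α → ℝ) :
    ∑ a ∈ A, ∑ S ∈ (A.erase a).powersetCard m, g (insert a S)
      = ((m : ℝ) + 1) * ∑ S ∈ A.powersetCard (m + 1), g S := by
  have h2 : ((m : ℝ) + 1) * ∑ S ∈ A.powersetCard (m + 1), g S
      = ∑ S ∈ A.powersetCard (m + 1), ∑ a ∈ S, g S := by
    rw [Finset.mul_sum]
    refine Finset.sum_congr rfl fun S hS => ?_
    rw [Finset.sum_const, (Finset.mem_powersetCard.1 hS).2]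
    simp
  rw [h2, Finset.sum_sigma', Finset.sum_sigma']
  refine Finset.sum_bij' (fun p _ => ⟨insert p.1 p.2, p.1⟩) (fun p _ => ⟨p.2, p.1.erase p.2⟩)
    ?_ ?_ ?_ ?_ ?_
  · rintro ⟨a, S⟩ h
    simp only [Finset.mem_sigma, Finset.mem_powersetCard] at h ⊢
    obtain ⟨ha, hS, hc⟩ := h
    have hn : a ∉ S := fun h => by simpa using hS h
    refine ⟨⟨?_, ?_⟩, by simp⟩
    · exact Finset.insert_subset ha (hS.trans (Finset.erase_subset _ _))
    · rw [Finset.card_insert_of_notMem hn, hc]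
  · rintro ⟨S, a⟩ h
    simp only [Finset.mem_sigma, Finset.mem_powersetCard] at h ⊢
    obtain ⟨⟨hS, hc⟩, ha⟩ := h
    refine ⟨hS ha, Finset.erase_subset_erase _ hS, ?_⟩
    rw [Finset.card_erase_of_mem ha, hc]; simp
  · rintro ⟨a, S⟩ h
    simp only [Finset.mem_sigma, Finset.mem_powersetCard] at h
    have hn : a ∉ S := fun h' => by simpa using h.2.1 h'
    simp [Finset.erase_insert hn]
  · rintro ⟨S, a⟩ h
    simp only [Finset.mem_sigma, Finset.mem_powersetCard] at h
    simp [Finset.insert_erase h.2]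
  · rintro ⟨a, S⟩ h
    rfl

lemma sAvg_succ {α : Type*} (m n : ℕ) (A : Finset α) (hA : A.card = n + 1) (hmn : m ≤ n)
    (g : Finset α → ℝ) :
    sAvg (m + 1) A g
      = (∑ a ∈ A, sAvg m (A.erase a) (fun S => g (insert a S))) / (A.card : ℝ) := by
  have h1 : ∑ a ∈ A, sAvg m (A.erase a) (fun S => g (insert a S))
      = (∑ a ∈ A, ∑ S ∈ (A.erase a).powersetCard m, g (insert a S)) / (n.choose m : ℝ) := by
    rw [Finset.sum_div]
    refine Finset.sum_congr rfl fun a ha => ?_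
    rw [sAvg, Finset.card_erase_of_mem ha, hA]; simp
  rw [h1, double_count, sAvg, hA]
  have h3 : ((n : ℝ) + 1) * (n.choose m : ℝ) = ((n + 1).choose (m + 1) : ℝ) * ((m : ℝ) + 1) := by
    exact_mod_cast Nat.add_one_mul_choose_eq n m
  have h4 : (0 : ℝ) < n.choose m := by exact_mod_cast Nat.choose_pos hmn
  have h5 : (0 : ℝ) < (n + 1).choose (m + 1) := by
    exact_mod_cast Nat.choose_pos (Nat.succ_le_succ hmn)
  push_cast
  field_simp
  linear_combination (∑ S ∈ A.powersetCard (m + 1), g S) * h3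

/-- swap bound -/
lemma swap_bound {α : Type*} (m u : ℕ) (hu : 1 ≤ u) (A : Finset α) (hA : A.card = m + 1 + u)
    (g : Finset α → ℝ) (β : ℝ) (hβ : 0 ≤ β)
    (hg : ∀ S ⊆ A, S.card = m → ∀ a ∈ A, ∀ b ∈ A, a ∉ S → b ∉ S →
      g (insert a S) - g (insert b S) ≤ β) (a b : α) (ha : a ∈ A) (hb : b ∈ A) :
    sAvg m (A.erase a) (fun S => g (insert a S)) - sAvg m (A.erase b) (fun S => g (insert b S))
      ≤ β * u / ((m : ℝ) + u) := by
  by_cases hab : a = b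
  · subst hab; simp; positivity
  have hca : (A.erase a).card = m + u := by rw [Finset.card_erase_of_mem ha, hA]; omega
  have hcb : (A.erase b).card = m + u := by rw [Finset.card_erase_of_mem hb, hA]; omega
  have himg : ∀ S : Finset α, S.image (Equiv.swap a b) = S.map (Equiv.swap a b).toEmbedding :=
    fun S => by rw [Finset.map_eq_image]; rfl
  have hinv : ∀ S : Finset α, (S.image (Equiv.swap a b)).image (Equiv.swap a b) = S := by
    intro S
    rw [Finset.image_image]
    have : (Equiv.swap a b : α → α) ∘ (Equiv.swap a b) = id := by ext x; simp
    rw [this, Finset.image_id]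
  have hsw : ∀ c d : α, c ∈ A → d ∈ A → (c = a ∧ d = b ∨ c = b ∧ d = a) →
      ∀ S ∈ (A.erase c).powersetCard m, S.image (Equiv.swap a b) ∈ (A.erase d).powersetCard m := by
    intro c d hc hd hcd S hS
    rw [Finset.mem_powersetCard] at hS ⊢
    refine ⟨?_, by rw [himg, Finset.card_map]; exact hS.2⟩
    intro x hx
    obtain ⟨z, hz, rfl⟩ := Finset.mem_image.1 hx
    have hz' := hS.1 hz
    rw [Finset.mem_erase] at hz' ⊢
    rcases hcd with ⟨rfl, rfl⟩ | ⟨rfl, rfl⟩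
    · refine ⟨fun h => hz'.1 ?_, ?_⟩
      · exact (Equiv.swap c d).injective (h.trans (Equiv.swap_apply_left c d).symm)
      · rw [Equiv.swap_apply_def]; split_ifs
        exacts [hd, hc, hz'.2]
    · refine ⟨fun h => hz'.1 ?_, ?_⟩
      · exact (Equiv.swap d c).injective (h.trans (Equiv.swap_apply_right d c).symm)
      · rw [Equiv.swap_apply_def]; split_ifs
        exacts [hc, hd, hz'.2]
  have hre : ∑ S ∈ (A.erase b).powersetCard m, g (insert b S)
      = ∑ S ∈ (A.erase a).powersetCard m, g (insert b (S.image (Equiv.swap a b))) := by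
    refine Finset.sum_bij' (fun S _ => S.image (Equiv.swap a b))
      (fun S _ => S.image (Equiv.swap a b)) (hsw b a hb ha (Or.inr ⟨rfl, rfl⟩))
      (hsw a b ha hb (Or.inl ⟨rfl, rfl⟩)) (fun S _ => hinv S) (fun S _ => hinv S) ?_
    intro S _
    rw [hinv]
  have hterm : ∀ S ∈ (A.erase a).powersetCard m,
      g (insert a S) - g (insert b (S.image (Equiv.swap a b))) ≤ if b ∈ S then 0 else β := by
    intro S hS
    rw [Finset.mem_powersetCard] at hS
    have haS : a ∉ S := fun h => by simpa using hS.1 h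
    split_ifs with hbS
    · have : insert b (S.image (Equiv.swap a b)) = insert a S := by
        ext x
        simp only [Finset.mem_insert, Finset.mem_image]
        constructor
        · rintro (rfl | ⟨z, hz, rfl⟩)
          · exact Or.inr hbS
          · rw [Equiv.swap_apply_def]; split_ifs with h1 h2
            · exact absurd (h1 ▸ hz) haS
            · exact Or.inl rfl
            · exact Or.inr hz
        · rintro (rfl | hx)
          · exact Or.inr ⟨b, hbS, by simp⟩
          · by_cases hxb : x = b
            · exact Or.inl hxb
            · refine Or.inr ⟨x, hx, ?_⟩
              rw [Equiv.swap_apply_of_ne_of_ne _ hxb]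
              rintro rfl; exact haS hx
      rw [this]; simp
    · have : S.image (Equiv.swap a b) = S := by
        conv_rhs => rw [← Finset.image_id (s := S)]
        refine Finset.image_congr fun x hx => ?_
        rw [id, Equiv.swap_apply_of_ne_of_ne]
        · rintro rfl; exact haS hx
        · rintro rfl; exact hbS hx
      rw [this]
      exact hg S (hS.1.trans (Finset.erase_subset _ _)) hS.2 a ha b hb haS hbS
  have hcount : ∑ S ∈ (A.erase a).powersetCard m, (if b ∈ S then 0 else β)
      = ((m + u - 1).choose m : ℝ) * β := by
    have e0 : ∀ S : Finset α, (if b ∈ S then 0 else β) = if ¬ b ∈ S then β else 0 := by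
      intro S; by_cases h : b ∈ S <;> simp [h]
    simp only [e0]
    rw [← Finset.sum_filter, Finset.sum_const, nsmul_eq_mul]
    congr 2
    have : ((A.erase a).powersetCard m).filter (fun S => ¬ b ∈ S)
        = ((A.erase a).erase b).powersetCard m := by
      ext S
      simp only [Finset.mem_filter, Finset.mem_powersetCard, Finset.subset_erase]
      tauto
    rw [this, Finset.card_powersetCard, Finset.card_erase_of_mem, hca]
    exact Finset.mem_erase.2 ⟨fun h => hab h.symm, hb⟩
  rw [sAvg, sAvg, hca, hcb, hre, ← sub_div, ← Finset.sum_sub_distrib]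
  have hpos : (0 : ℝ) < (m + u).choose m := by exact_mod_cast Nat.choose_pos (by omega)
  rw [div_le_iff₀ hpos]
  refine (Finset.sum_le_sum hterm).trans (le_of_eq ?_)
  rw [hcount]
  obtain ⟨v, rfl⟩ : ∃ v, u = v + 1 := ⟨u - 1, by omega⟩
  have h6 : (((m + v).choose m : ℕ) : ℝ) * ((m : ℝ) + v + 1)
      = (((m + v + 1).choose m : ℕ) : ℝ) * (v + 1) := by
    have := Nat.choose_mul_succ_eq (m + v) m
    have h7 : m + v + 1 - m = v + 1 := by omega
    rw [h7] at this
    exact_mod_cast this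
  have h8 : m + (v + 1) - 1 = m + v := by omega
  rw [h8, ← add_assoc]
  push_cast
  have : (0 : ℝ) < (m : ℝ) + (v + 1) := by positivity
  field_simp
  linear_combination β * h6

lemma sAvg_congr {α : Type*} (m : ℕ) (A : Finset α) (f g : Finset α → ℝ)
    (h : ∀ S ∈ A.powersetCard m, f S = g S) : sAvg m A f = sAvg m A g := by
  rw [sAvg, sAvg, Finset.sum_congr rfl h]

lemma sAvg_mul {α : Type*} (m : ℕ) (A : Finset α) (c : ℝ) (g : Finset α → ℝ) :
    sAvg m A (fun S => c * g S) = c * sAvg m A g := by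
  rw [sAvg, sAvg, ← Finset.mul_sum, mul_div_assoc]

lemma mgf_bound {α : Type*} (u : ℕ) (hu : 1 ≤ u) (β : ℝ) (hβ : 0 ≤ β) (l : ℝ) (m : ℕ) :
    ∀ (A : Finset α), A.card = m + u → ∀ (g : Finset α → ℝ),
    (∀ S ⊆ A, S.card + 1 = m → ∀ a ∈ A, ∀ b ∈ A, a ∉ S → b ∉ S →
      g (insert a S) - g (insert b S) ≤ β) →
    sAvg m A (fun S => Real.exp (l * (g S - sAvg m A g)))
      ≤ Real.exp (l ^ 2 / 8 * (β ^ 2 * u ^ 2 * ∑ j ∈ Finset.range m, 1 / ((u : ℝ) + j) ^ 2)) := by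
  induction m with
  | zero =>
    intro A hA g hg
    simp [sAvg]
  | succ m ih =>
    intro A hA g hg
    set h : α → ℝ := fun a => sAvg m (A.erase a) (fun S => g (insert a S)) with hh
    have hmean : sAvg (m + 1) A g = (∑ a ∈ A, h a) / (A.card : ℝ) :=
      sAvg_succ m (m + u) A (by omega) (by omega) g
    rw [sAvg_succ m (m + u) A (by omega) (by omega)]
    have hA' : A.Nonempty := Finset.card_pos.1 (by omega)
    have hcp : (0 : ℝ) < A.card := by exact_mod_cast Finset.card_pos.2 hA'
    set C := Real.exp (l ^ 2 / 8 * (β ^ 2 * u ^ 2 *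
      ∑ j ∈ Finset.range m, 1 / ((u : ℝ) + j) ^ 2)) with hC
    have hin : ∀ a ∈ A, sAvg m (A.erase a)
        (fun S => Real.exp (l * (g (insert a S) - sAvg (m + 1) A g)))
        ≤ Real.exp (l * (h a - (∑ a ∈ A, h a) / (A.card : ℝ))) * C := by
      intro a ha
      have e1 : (fun S => Real.exp (l * (g (insert a S) - sAvg (m + 1) A g)))
          = fun S => Real.exp (l * (h a - (∑ a ∈ A, h a) / (A.card : ℝ))) *
            Real.exp (l * (g (insert a S) - h a)) := by
        funext S
        rw [← Real.exp_add, hmean]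
        congr 1; ring
      rw [e1, sAvg_mul]
      refine mul_le_mul_of_nonneg_left ?_ (Real.exp_pos _).le
      refine ih (A.erase a) (by rw [Finset.card_erase_of_mem ha]; omega)
        (fun S => g (insert a S)) ?_
      intro S hS hc b hb d hd hbS hdS
      have haS : a ∉ S := fun h => by simpa using hS h
      rw [Finset.mem_erase] at hb hd
      have := hg (insert a S) (Finset.insert_subset ha (hS.trans (Finset.erase_subset _ _)))
        (by rw [Finset.card_insert_of_notMem haS, hc]) b hb.2 d hd.2
        (by simp [hb.1, hbS]) (by simp [hd.1, hdS])
      simpa [Finset.insert_comm] using this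
    have hho := hoeff_aux A hA' h (β * u / ((m : ℝ) + u)) (fun a ha b hb =>
      swap_bound m u hu A hA g β hβ (fun S hS hc => hg S hS (by omega)) a b ha hb) l
    calc _ ≤ (∑ a ∈ A, Real.exp (l * (h a - (∑ a ∈ A, h a) / (A.card : ℝ))) * C) / (A.card : ℝ) :=
          div_le_div_of_nonneg_right (Finset.sum_le_sum hin) hcp.le
      _ = (∑ a ∈ A, Real.exp (l * (h a - (∑ a ∈ A, h a) / (A.card : ℝ)))) / (A.card : ℝ) * C := by
          rw [← Finset.sum_mul]; ring
      _ ≤ Real.exp (l ^ 2 / 8 * (β * u / ((m : ℝ) + u)) ^ 2) * C :=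
          mul_le_mul_of_nonneg_right hho (Real.exp_pos _).le
      _ = _ := by
          rw [hC, ← Real.exp_add, Finset.sum_range_succ]
          congr 1
          have : (0 : ℝ) < (m : ℝ) + u := by positivity
          have h' : (u : ℝ) + m = m + u := add_comm _ _
          rw [h']
          field_simp
          ring

lemma sum_inv_sq (u : ℕ) (hu : 1 ≤ u) (m : ℕ) :
    ∑ j ∈ Finset.range m, 1 / ((u : ℝ) + j) ^ 2
      ≤ (m : ℝ) / (((u : ℝ) - 1 / 2) * ((m : ℝ) + u - 1 / 2)) := by
  have hu' : (1 : ℝ) ≤ u := by exact_mod_cast hu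
  have key : ∀ m : ℕ, ∑ j ∈ Finset.range m, 1 / ((u : ℝ) + j) ^ 2
      ≤ 1 / ((u : ℝ) - 1 / 2) - 1 / ((m : ℝ) + u - 1 / 2) := by
    intro m
    induction m with
    | zero => simp
    | succ k ih =>
      rw [Finset.sum_range_succ]
      have hk : (0 : ℝ) ≤ k := by positivity
      have : 1 / ((u : ℝ) + k) ^ 2 ≤ 1 / ((k : ℝ) + u - 1 / 2) - 1 / (((k : ℝ) + 1) + u - 1 / 2) := by
        rw [div_sub_div _ _ (by linarith) (by linarith)]
        rw [div_le_div_iff₀ (by positivity) (by apply mul_pos <;> linarith)]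
        nlinarith
      push_cast
      linarith
  refine (key m).trans (le_of_eq ?_)
  have h1 : (u : ℝ) - 1 / 2 ≠ 0 := by linarith
  have h2 : (m : ℝ) + u - 1 / 2 ≠ 0 := by
    have : (0 : ℝ) ≤ m := by positivity
    linarith
  rw [div_sub_div _ _ h1 h2]
  congr 1
  ring

lemma pexp_image {N m : ℕ} (P : Finset (Fin N)) (hP : P.card = m) (G : Finset (Fin N) → ℝ) :
    pexp (fun π : Equiv.Perm (Fin N) => G (P.image π)) = sAvg m Finset.univ G := by
  set k : ℕ := (Finset.univ.filter (fun π : Equiv.Perm (Fin N) => P.image π = P)).card with hk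
  have himg : ∀ π : Equiv.Perm (Fin N), P.image π ∈ (Finset.univ : Finset (Fin N)).powersetCard m := by
    intro π
    rw [Finset.mem_powersetCard, Finset.card_image_of_injective _ π.injective]
    exact ⟨Finset.subset_univ _, hP⟩
  have hfib : ∀ S ∈ (Finset.univ : Finset (Fin N)).powersetCard m,
      (Finset.univ.filter (fun π : Equiv.Perm (Fin N) => P.image π = S)).card = k := by
    intro S hS
    have hSc := (Finset.mem_powersetCard.1 hS).2
    let e : {x // x ∈ P} ≃ {x // x ∈ S} := Finset.equivOfCardEq (hP.trans hSc.symm)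
    let σ : Equiv.Perm (Fin N) := e.extendSubtype
    have hσ : P.image σ = S := by
      refine Finset.eq_of_subset_of_card_le ?_ ?_
      · intro z hz
        obtain ⟨w, hw, rfl⟩ := Finset.mem_image.1 hz
        exact e.extendSubtype_mem w hw
      · rw [Finset.card_image_of_injective _ σ.injective, hP, hSc]
    have hcomp : ∀ (τ π : Equiv.Perm (Fin N)), P.image (τ * π : Equiv.Perm (Fin N))
        = (P.image π).image τ := by
      intro τ π
      rw [Finset.image_image]; rfl
    have hσ' : S.image (σ⁻¹ : Equiv.Perm (Fin N)) = P := by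
      rw [← hσ, ← hcomp]; simp
    symm
    refine Finset.card_bij' (fun π _ => σ * π) (fun π _ => σ⁻¹ * π) ?_ ?_ ?_ ?_
    · intro π hπ
      rw [Finset.mem_filter] at hπ ⊢
      exact ⟨Finset.mem_univ _, by rw [hcomp, hπ.2, hσ]⟩
    · intro π hπ
      rw [Finset.mem_filter] at hπ ⊢
      exact ⟨Finset.mem_univ _, by rw [hcomp, hπ.2, hσ']⟩
    · intro π _; simp
    · intro π _; simp
  have hsum : ∀ H : Finset (Fin N) → ℝ, ∑ π : Equiv.Perm (Fin N), H (P.image π)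
      = (k : ℝ) * ∑ S ∈ (Finset.univ : Finset (Fin N)).powersetCard m, H S := by
    intro H
    rw [← Finset.sum_fiberwise_of_maps_to (s := Finset.univ)
      (t := (Finset.univ : Finset (Fin N)).powersetCard m)
      (g := fun π : Equiv.Perm (Fin N) => P.image π) (fun π _ => himg π), Finset.mul_sum]
    refine Finset.sum_congr rfl fun S hS => ?_
    rw [← hfib S hS, ← nsmul_eq_mul, ← Finset.sum_const]
    refine Finset.sum_congr rfl fun π hπ => ?_
    rw [(Finset.mem_filter.1 hπ).2]
  have h1 := hsum (fun _ => 1)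
  simp only [Finset.sum_const, Finset.card_powersetCard, nsmul_eq_mul, mul_one,
    Finset.card_univ] at h1
  have hpos : (0 : ℝ) < Fintype.card (Equiv.Perm (Fin N)) := by exact_mod_cast Fintype.card_pos
  have hk0 : (k : ℝ) ≠ 0 := by
    intro h; rw [h1, h] at hpos; simp at hpos
  rw [pexp, sAvg, hsum, h1, Finset.card_univ, mul_div_mul_left _ _ hk0]

lemma tail_bound {α : Type*} (m u : ℕ) (hm : 1 ≤ m) (hu : 1 ≤ u) (A : Finset α)
    (hA : A.card = m + u) (g : Finset α → ℝ) (β : ℝ) (hβ : 0 < β)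
    (hg : ∀ S ⊆ A, S.card + 1 = m → ∀ a ∈ A, ∀ b ∈ A, a ∉ S → b ∉ S →
      g (insert a S) - g (insert b S) ≤ β) (δ : ℝ) (hδ0 : 0 < δ) (hδ1 : δ < 1) :
    sAvg m A (fun S => if sAvg m A g + Real.sqrt ((m : ℝ) * u * β ^ 2 /
      (2 * ((m : ℝ) + u - 1 / 2)) * (1 - 1 / (2 * (u : ℝ)))⁻¹ * Real.log (1 / δ)) < g S
      then 1 else 0) ≤ δ := by
  have hu' : (1 : ℝ) ≤ u := by exact_mod_cast hu
  have hm' : (1 : ℝ) ≤ m := by exact_mod_cast hm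
  have h1 : (0 : ℝ) < u - 1 / 2 := by linarith
  have h2 : (0 : ℝ) < (m : ℝ) + u - 1 / 2 := by linarith
  have h3 : 1 - 1 / (2 * (u : ℝ)) = (u - 1 / 2) / u := by field_simp
  set W : ℝ := (m : ℝ) * u * β ^ 2 / (2 * ((m : ℝ) + u - 1 / 2)) * (1 - 1 / (2 * (u : ℝ)))⁻¹ with hW
  have hW0 : 0 < W := by
    rw [hW, h3]; positivity
  set L := Real.log (1 / δ) with hL
  have hL0 : 0 < L := Real.log_pos (by rw [lt_div_iff₀ hδ0]; linarith)
  set ε := Real.sqrt (W * L) with hε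
  have hε0 : 0 < ε := Real.sqrt_pos.2 (by positivity)
  have hε2 : ε ^ 2 = W * L := Real.sq_sqrt (by positivity)
  set l := 2 * ε / W with hl
  have hl0 : 0 < l := by positivity
  have hmgf := mgf_bound u hu β hβ.le l m A hA g hg
  have hV : β ^ 2 * (u : ℝ) ^ 2 * ∑ j ∈ Finset.range m, 1 / ((u : ℝ) + j) ^ 2 ≤ 2 * W := by
    refine (mul_le_mul_of_nonneg_left (sum_inv_sq u hu m) (by positivity)).trans (le_of_eq ?_)
    rw [hW, h3]
    field_simp
  have hstep : sAvg m A (fun S => if sAvg m A g + ε < g S then 1 else 0)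
      ≤ sAvg m A (fun S => Real.exp (-(l * ε)) * Real.exp (l * (g S - sAvg m A g))) := by
    refine div_le_div_of_nonneg_right (Finset.sum_le_sum fun S _ => ?_) (by positivity)
    split_ifs with h
    · rw [← Real.exp_add]
      refine Real.one_le_exp ?_
      nlinarith
    · positivity
  refine hstep.trans ?_
  rw [sAvg_mul]
  calc _ ≤ Real.exp (-(l * ε)) * Real.exp (l ^ 2 / 8 * (2 * W)) := by
        refine mul_le_mul_of_nonneg_left (hmgf.trans (Real.exp_le_exp.2 ?_)) (Real.exp_pos _).le
        exact mul_le_mul_of_nonneg_left hV (by positivity)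
    _ = Real.exp (-L) := by
        rw [← Real.exp_add]
        congr 1
        have e1 : l * ε = 2 * L := by
          rw [hl]; field_simp; rw [hε2]
        have e2 : l ^ 2 / 8 * (2 * W) = L := by
          rw [hl]; field_simp; rw [hε2]; ring
        rw [e1, e2]; ring
    _ = δ := by
        rw [hL, one_div, Real.log_inv, neg_neg, Real.exp_log hδ0]

lemma card_first (m u : ℕ) :
    (Finset.univ.filter (fun k : Fin (m + u) => (k : ℕ) < m)).card = m := by
  rw [Fin.card_filter_val_lt]; simp

lemma testIdx_eq (m u : ℕ) (π : Equiv.Perm (Fin (m + u))) : testIdx m u π = (trainIdx m u π)ᶜ := by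
  ext z
  simp only [testIdx, trainIdx, Finset.mem_image, Finset.mem_compl, Finset.mem_filter,
    Finset.mem_univ, true_and]
  constructor
  · rintro ⟨k, hk, rfl⟩ ⟨k', hk', h⟩
    rw [π.injective h] at hk'; omega
  · intro h
    refine ⟨π.symm z, ?_, by simp⟩
    by_contra hc
    exact h ⟨π.symm z, by omega, by simp⟩

lemma compl_insert_swap {N : ℕ} (S : Finset (Fin N)) (a b : Fin N) (hab : a ≠ b) (hb : b ∉ S) :
    (insert a S)ᶜ = insert b (insert a (insert b S))ᶜ := by
  ext z
  simp only [Finset.mem_compl, Finset.mem_insert]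
  by_cases h : z = b
  · subst h; simp [hb, hab.symm]
  · simp [h]

lemma perm_tail (m u : ℕ) (hm : 1 ≤ m) (hu : 1 ≤ u)
    (G : Finset (Fin (m + u)) → ℝ) (β : ℝ) (hβ : 0 < β)
    (hg : ∀ S, S.card + 1 = m → ∀ a b, a ∉ S → b ∉ S →
      G (insert a S) - G (insert b S) ≤ β) (δ : ℝ) (hδ0 : 0 < δ) (hδ1 : δ < 1) :
    pexp (fun π => if pexp (fun π' => G (trainIdx m u π')) + Real.sqrt ((m : ℝ) * u * β ^ 2 /
      (2 * ((m : ℝ) + u - 1 / 2)) * (1 - 1 / (2 * (max m u : ℝ)))⁻¹ * Real.log (1 / δ))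
        < G (trainIdx m u π) then 1 else 0) ≤ δ := by
  rcases le_total m u with h | h
  · have hmax : max (m : ℝ) (u : ℝ) = u := max_eq_right (by exact_mod_cast h)
    rw [hmax]
    have hE : ∀ H : Finset (Fin (m + u)) → ℝ,
        pexp (fun π => H (trainIdx m u π)) = sAvg m Finset.univ H := fun H =>
      pexp_image _ (card_first m u) H
    rw [hE G]
    have := tail_bound m u hm hu (Finset.univ : Finset (Fin (m + u))) (by simp) G β hβ
      (fun S _ hc a _ b _ ha hb => by convert hg S hc a b ha hb) δ hδ0 hδ1
    rwa [← hE] at this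
  · have hmax : max (m : ℝ) (u : ℝ) = m := max_eq_left (by exact_mod_cast h)
    rw [hmax]
    have hcard : (Finset.univ.filter (fun k : Fin (m + u) => m ≤ (k : ℕ))).card = u := by
      have := Finset.card_filter_add_card_filter_not (s := (Finset.univ : Finset (Fin (m + u))))
        (fun k : Fin (m + u) => (k : ℕ) < m)
      rw [card_first] at this
      simp only [not_lt, Finset.card_univ, Fintype.card_fin] at this
      omega
    have hE' : ∀ H : Finset (Fin (m + u)) → ℝ,
        pexp (fun π => H (testIdx m u π)) = sAvg u Finset.univ H := fun H =>
      pexp_image _ hcard H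
    have hE : ∀ H : Finset (Fin (m + u)) → ℝ,
        pexp (fun π => H (trainIdx m u π)) = sAvg u Finset.univ (fun T => H Tᶜ) := by
      intro H
      rw [← hE']
      simp only [testIdx_eq, compl_compl]
    rw [hE G]
    have := tail_bound u m hu hm (Finset.univ : Finset (Fin (m + u))) (by simp [add_comm])
      (fun T => G Tᶜ) β hβ
      (fun S _ hc a _ b _ ha hb => by
        by_cases hab : a = b
        · subst hab; simpa using hβ.le
        · suffices hkey : G (insert a S)ᶜ - G (insert b S)ᶜ ≤ β by convert hkey
          rw [compl_insert_swap S a b hab hb, compl_insert_swap S b a (Ne.symm hab) ha,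
            Finset.insert_comm b a]
          refine hg _ ?_ _ _ (by simp) (by simp)
          rw [Finset.card_compl, Finset.card_insert_of_notMem (by simp [hab, ha]),
            Finset.card_insert_of_notMem hb, Fintype.card_fin]
          omega) δ hδ0 hδ1
    rw [← hE (fun S => if sAvg u Finset.univ (fun T => G Tᶜ) + Real.sqrt ((u : ℝ) * m * β ^ 2 /
      (2 * ((u : ℝ) + m - 1 / 2)) * (1 - 1 / (2 * (m : ℝ)))⁻¹ * Real.log (1 / δ)) < G S
        then 1 else 0)] at this
    rw [mul_comm (m : ℝ) u, add_comm (m : ℝ) u]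
    exact this

lemma pexp_mono {N : ℕ} (f g : Equiv.Perm (Fin N) → ℝ) (h : ∀ π, f π ≤ g π) : pexp f ≤ pexp g :=
  div_le_div_of_nonneg_right (Finset.sum_le_sum fun π _ => h π) (by positivity)

lemma conc {ι : Type*} [Nonempty ι] (m u : ℕ) (hm : 1 ≤ m) (hu : 1 ≤ u)
    (p q : ι → Fin (m + u) → ℝ) (hp0 : ∀ i k, 0 ≤ p i k) (hp1 : ∀ i k, p i k ≤ 1)
    (hq0 : ∀ i k, 0 ≤ q i k) (hq1 : ∀ i k, q i k ≤ 1)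
    (B : Equiv.Perm (Fin (m + u)) → ℝ)
    (hB : ∀ i π, 1 / (u : ℝ) * ∑ k ∈ testIdx m u π, p i k
      - 1 / (m : ℝ) * ∑ k ∈ trainIdx m u π, q i k ≤ B π)
    (δ : ℝ) (hδ0 : 0 < δ) (hδ1 : δ < 1) :
    1 - δ ≤ ((Finset.univ.filter (fun π : Equiv.Perm (Fin (m + u)) =>
      ∀ i, 1 / (u : ℝ) * ∑ k ∈ testIdx m u π, p i k
      - 1 / (m : ℝ) * ∑ k ∈ trainIdx m u π, q i k ≤ pexp B +
        Real.sqrt ((m : ℝ) * u * (1 / (m : ℝ) + 1 / (u : ℝ)) ^ 2 /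
      (2 * ((m : ℝ) + u - 1 / 2)) * (1 - 1 / (2 * (max m u : ℝ)))⁻¹ * Real.log (1 / δ)))).card : ℝ) /
        (Fintype.card (Equiv.Perm (Fin (m + u))) : ℝ) := by
  have hu' : (0 : ℝ) < u := by exact_mod_cast hu
  have hm' : (0 : ℝ) < m := by exact_mod_cast hm
  set Q : ι → Finset (Fin (m + u)) → ℝ := fun i S =>
    1 / (u : ℝ) * ∑ k ∈ Sᶜ, p i k - 1 / (m : ℝ) * ∑ k ∈ S, q i k with hQ
  have hbdd : ∀ S, BddAbove (Set.range fun i => Q i S) := by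
    intro S
    refine ⟨1 / (u : ℝ) * ∑ k ∈ Sᶜ, 1, ?_⟩
    rintro _ ⟨i, rfl⟩
    have a1 : ∑ k ∈ Sᶜ, p i k ≤ ∑ k ∈ Sᶜ, (1 : ℝ) := Finset.sum_le_sum fun k _ => hp1 i k
    have a2 : 0 ≤ ∑ k ∈ S, q i k := Finset.sum_nonneg fun k _ => hq0 i k
    have a3 : 0 ≤ 1 / (m : ℝ) * ∑ k ∈ S, q i k := by positivity
    have a4 := mul_le_mul_of_nonneg_left a1 (by positivity : 0 ≤ 1 / (u : ℝ))
    simp only [hQ]; linarith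
  set G : Finset (Fin (m + u)) → ℝ := fun S => ⨆ i, Q i S with hG
  have hβ : 0 < 1 / (m : ℝ) + 1 / (u : ℝ) := by positivity
  have hswap : ∀ S : Finset (Fin (m + u)), S.card + 1 = m → ∀ a b, a ∉ S → b ∉ S →
      G (insert a S) - G (insert b S) ≤ 1 / (m : ℝ) + 1 / (u : ℝ) := by
    intro S _ a b ha hb
    by_cases hab : a = b
    · subst hab; simpa using hβ.le
    rw [sub_le_iff_le_add]
    refine ciSup_le fun i => ?_
    have h1 : Q i (insert b S) ≤ G (insert b S) := le_ciSup (hbdd _) i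
    have h2 : Q i (insert a S) - Q i (insert b S) ≤ 1 / (m : ℝ) + 1 / (u : ℝ) := by
      simp only [hQ]
      rw [compl_insert_swap S a b hab hb, compl_insert_swap S b a (Ne.symm hab) ha,
        Finset.insert_comm b a, Finset.sum_insert ha, Finset.sum_insert hb,
        Finset.sum_insert (by simp), Finset.sum_insert (by simp)]
      have b1 : 1 / (u : ℝ) * (p i b - p i a) ≤ 1 / (u : ℝ) * 1 :=
        mul_le_mul_of_nonneg_left (by linarith [hp1 i b, hp0 i a]) (by positivity)
      have b2 : 1 / (m : ℝ) * (q i b - q i a) ≤ 1 / (m : ℝ) * 1 :=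
        mul_le_mul_of_nonneg_left (by linarith [hq1 i b, hq0 i a]) (by positivity)
      linarith
    linarith
  have htail := perm_tail m u hm hu G _ hβ hswap δ hδ0 hδ1
  have hmean : pexp (fun π => G (trainIdx m u π)) ≤ pexp B := by
    refine pexp_mono _ _ fun π => ciSup_le fun i => ?_
    have := hB i π
    rwa [testIdx_eq] at this
  set ε := Real.sqrt ((m : ℝ) * u * (1 / (m : ℝ) + 1 / (u : ℝ)) ^ 2 /
      (2 * ((m : ℝ) + u - 1 / 2)) * (1 - 1 / (2 * (max m u : ℝ)))⁻¹ * Real.log (1 / δ)) with hε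
  have hcp : (0 : ℝ) < Fintype.card (Equiv.Perm (Fin (m + u))) := by exact_mod_cast Fintype.card_pos
  rw [pexp, div_le_iff₀ hcp] at htail
  rw [le_div_iff₀ hcp]
  have hone : (Fintype.card (Equiv.Perm (Fin (m + u))) : ℝ)
      = ∑ π : Equiv.Perm (Fin (m + u)), (1 : ℝ) := by simp
  rw [Finset.card_filter, Nat.cast_sum]
  have hsum : ∑ π : Equiv.Perm (Fin (m + u)), (1 : ℝ) ≤
      ∑ π : Equiv.Perm (Fin (m + u)), ((if pexp (fun π' => G (trainIdx m u π')) + ε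
        < G (trainIdx m u π) then (1 : ℝ) else 0) + (((if ∀ i, 1 / (u : ℝ) * ∑ k ∈ testIdx m u π, p i k
      - 1 / (m : ℝ) * ∑ k ∈ trainIdx m u π, q i k ≤ pexp B + ε then 1 else 0 : ℕ) : ℝ))) := by
    refine Finset.sum_le_sum fun π _ => ?_
    by_cases h : pexp (fun π' => G (trainIdx m u π')) + ε < G (trainIdx m u π)
    · rw [if_pos h]
      have : (0 : ℝ) ≤ (((if ∀ i, 1 / (u : ℝ) * ∑ k ∈ testIdx m u π, p i k
        - 1 / (m : ℝ) * ∑ k ∈ trainIdx m u π, q i k ≤ pexp B + ε then 1 else 0 : ℕ) : ℝ)) :=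
        Nat.cast_nonneg _
      linarith
    · rw [if_neg h, if_pos]
      · simp
      · intro i
        have h1 : Q i (trainIdx m u π) ≤ G (trainIdx m u π) := le_ciSup (hbdd _) i
        rw [testIdx_eq]
        simp only [hQ] at h1
        push Not at h
        linarith
  rw [Finset.sum_add_distrib, ← hone] at hsum
  linarith

/-- ramp loss -/
noncomputable def ramp (γ t : ℝ) : ℝ := max 0 (min 1 (1 - t / γ))

lemma ramp_nonneg (γ t : ℝ) : 0 ≤ ramp γ t := le_max_left _ _

lemma ramp_le_one (γ t : ℝ) : ramp γ t ≤ 1 := max_le zero_le_one (min_le_left _ _)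

lemma le_ramp (γ t : ℝ) (hγ : 0 < γ) : (if t ≤ 0 then (1 : ℝ) else 0) ≤ ramp γ t := by
  split_ifs with h
  · have : t / γ ≤ 0 := div_nonpos_of_nonpos_of_nonneg h hγ.le
    exact le_max_of_le_right (le_min le_rfl (by linarith))
  · exact ramp_nonneg _ _

lemma ramp_le (γ t : ℝ) (hγ : 0 < γ) : ramp γ t ≤ (if t ≤ γ then (1 : ℝ) else 0) := by
  split_ifs with h
  · exact ramp_le_one _ _
  · push Not at h
    have : 1 < t / γ := by rwa [lt_div_iff₀ hγ, one_mul]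
    exact max_le le_rfl ((min_le_right _ _).trans (by linarith))

lemma ramp_lip (γ s t : ℝ) (hγ : 0 < γ) : ramp γ s - ramp γ t ≤ |s - t| / γ := by
  have h1 : |ramp γ s - ramp γ t| ≤ |(1 - s / γ) - (1 - t / γ)| := by
    unfold ramp
    have h2 := abs_max_sub_max_le_abs (min 1 (1 - s / γ)) (min 1 (1 - t / γ)) 0
    have h3 := abs_min_sub_min_le_max 1 (1 - s / γ) 1 (1 - t / γ)
    rw [max_comm 0, max_comm 0]
    refine h2.trans (h3.trans ?_)
    simp
  have h4 : |(1 - s / γ) - (1 - t / γ)| = |s - t| / γ := by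
    rw [← abs_of_pos hγ, ← abs_div, ← abs_neg, abs_of_pos hγ]
    congr 1; ring
  rw [h4] at h1
  exact (le_abs_self _).trans h1

lemma empW_bound {ι α : Type*} (S T : Finset ι) (hS : S.Nonempty) (hT : T.Nonempty) (z : ι → α)
    (c : α → α → ℝ) (M : ℝ) (hM : 0 ≤ M) (v : ι → ℝ)
    (hv : ∀ i ∈ S, ∀ j ∈ T, v j - v i ≤ M * c (z i) (z j)) :
    (∑ j ∈ T, v j) / (T.card : ℝ) - (∑ i ∈ S, v i) / (S.card : ℝ) ≤ M * empW S T z c := by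
  have hSc : (S.card : ℝ) ≠ 0 := by exact_mod_cast (Finset.card_pos.2 hS).ne'
  have hTc : (T.card : ℝ) ≠ 0 := by exact_mod_cast (Finset.card_pos.2 hT).ne'
  have key : ∀ w ∈ { w : ℝ | ∃ Γ : ι → ι → ℝ,
    (∀ i ∈ S, ∀ j ∈ T, 0 ≤ Γ i j) ∧
    (∀ i ∈ S, ∑ j ∈ T, Γ i j = 1 / (S.card : ℝ)) ∧
    (∀ j ∈ T, ∑ i ∈ S, Γ i j = 1 / (T.card : ℝ)) ∧
    w = ∑ i ∈ S, ∑ j ∈ T, Γ i j * c (z i) (z j) },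
      (∑ j ∈ T, v j) / (T.card : ℝ) - (∑ i ∈ S, v i) / (S.card : ℝ) ≤ M * w := by
    rintro w ⟨Γ, h0, h1, h2, rfl⟩
    have e1 : (∑ j ∈ T, v j) / (T.card : ℝ) = ∑ i ∈ S, ∑ j ∈ T, Γ i j * v j := by
      rw [Finset.sum_comm, Finset.sum_div]
      refine Finset.sum_congr rfl fun j hj => ?_
      rw [← Finset.sum_mul, h2 j hj]; ring
    have e2 : (∑ i ∈ S, v i) / (S.card : ℝ) = ∑ i ∈ S, ∑ j ∈ T, Γ i j * v i := by
      rw [Finset.sum_div]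
      refine Finset.sum_congr rfl fun i hi => ?_
      rw [← Finset.sum_mul, h1 i hi]; ring
    rw [e1, e2, ← Finset.sum_sub_distrib, Finset.mul_sum]
    refine Finset.sum_le_sum fun i hi => ?_
    rw [← Finset.sum_sub_distrib, Finset.mul_sum]
    refine Finset.sum_le_sum fun j hj => ?_
    have := mul_le_mul_of_nonneg_left (hv i hi j hj) (h0 i hi j hj)
    linarith
  have hne : { w : ℝ | ∃ Γ : ι → ι → ℝ,
    (∀ i ∈ S, ∀ j ∈ T, 0 ≤ Γ i j) ∧
    (∀ i ∈ S, ∑ j ∈ T, Γ i j = 1 / (S.card : ℝ)) ∧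
    (∀ j ∈ T, ∑ i ∈ S, Γ i j = 1 / (T.card : ℝ)) ∧
    w = ∑ i ∈ S, ∑ j ∈ T, Γ i j * c (z i) (z j) }.Nonempty := by
    refine ⟨_, fun _ _ => 1 / ((S.card : ℝ) * T.card), ?_, ?_, ?_, rfl⟩
    · intro i _ j _; positivity
    · intro i _; rw [Finset.sum_const, nsmul_eq_mul]; field_simp
    · intro i _; rw [Finset.sum_const, nsmul_eq_mul]; field_simp
  rcases hM.eq_or_lt with h | h
  · obtain ⟨w, hw⟩ := hne
    have := key w hw
    rw [← h] at this ⊢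
    simpa using this
  · rw [← div_le_iff₀' h]
    refine le_csInf hne fun w hw => ?_
    rw [div_le_iff₀' h]
    exact key w hw

lemma det_bound {D K m u : ℕ} (hm : 1 ≤ m) (hu : 1 ≤ u)
    (ζ : Fin (m + u) → EuclideanSpace ℝ (Fin D)) (y : Fin (m + u) → Fin K)
    (f : EuclideanSpace ℝ (Fin D) → Fin K → ℝ) (γ : ℝ) (hγ : 0 < γ)
    (Mc : Fin K → ℝ) (hMc0 : ∀ c, 0 ≤ Mc c)
    (hMc : ∀ c : Fin K, ∀ i j : Fin (m + u), i ≠ j →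
      |margin f (ζ i) c - margin f (ζ j) c| ≤ Mc c * ‖ζ i - ζ j‖)
    (π : Equiv.Perm (Fin (m + u))) :
    testErr ζ y f π - trainErr ζ y f γ π ≤
      (∑ c : Fin K, (Mc c / γ) *
        (((((trainIdx m u π).filter (fun i => y i = c)).card : ℝ) / (m : ℝ)) * Wclass ζ y c π))
      + ∑ c : Fin K, |(((testIdx m u π).filter (fun i => y i = c)).card : ℝ) / (u : ℝ)
                    - (((trainIdx m u π).filter (fun i => y i = c)).card : ℝ) / (m : ℝ)| := by
  have hu' : (0 : ℝ) < u := by exact_mod_cast hu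
  have hm' : (0 : ℝ) < m := by exact_mod_cast hm
  set v : Fin (m + u) → ℝ := fun i => ramp γ (margin f (ζ i) (y i)) with hv
  have hv0 : ∀ i, 0 ≤ v i := fun i => ramp_nonneg _ _
  have hv1 : ∀ i, v i ≤ 1 := fun i => ramp_le_one _ _
  have h1 : testErr ζ y f π ≤ 1 / (u : ℝ) * ∑ i ∈ testIdx m u π, v i :=
    mul_le_mul_of_nonneg_left (Finset.sum_le_sum fun i _ => le_ramp _ _ hγ) (by positivity)
  have h2 : 1 / (m : ℝ) * ∑ i ∈ trainIdx m u π, v i ≤ trainErr ζ y f γ π :=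
    mul_le_mul_of_nonneg_left (Finset.sum_le_sum fun i _ => ramp_le _ _ hγ) (by positivity)
  have hsplit : ∀ S : Finset (Fin (m + u)), ∑ i ∈ S, v i
      = ∑ c : Fin K, ∑ i ∈ S.filter (fun i => y i = c), v i := fun S =>
    (Finset.sum_fiberwise S y v).symm
  have h3 : testErr ζ y f π - trainErr ζ y f γ π ≤
      ∑ c : Fin K, (1 / (u : ℝ) * ∑ i ∈ (testIdx m u π).filter (fun i => y i = c), v i
        - 1 / (m : ℝ) * ∑ i ∈ (trainIdx m u π).filter (fun i => y i = c), v i) := by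
    rw [Finset.sum_sub_distrib, ← Finset.mul_sum, ← Finset.mul_sum, ← hsplit, ← hsplit]
    linarith
  refine h3.trans ?_
  rw [← Finset.sum_add_distrib]
  refine Finset.sum_le_sum fun c _ => ?_
  unfold Wclass
  have hdisj : ∀ i ∈ trainIdx m u π, ∀ j ∈ testIdx m u π, i ≠ j := by
    intro i hi j hj h
    rw [testIdx_eq, Finset.mem_compl] at hj
    exact hj (h ▸ hi)
  set S := (trainIdx m u π).filter (fun i => y i = c) with hSdef
  set T := (testIdx m u π).filter (fun i => y i = c) with hTdef
  have hT0 : 0 ≤ ∑ i ∈ T, v i := Finset.sum_nonneg fun i _ => hv0 i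
  have hS0 : 0 ≤ ∑ i ∈ S, v i := Finset.sum_nonneg fun i _ => hv0 i
  have hT1 : ∑ i ∈ T, v i ≤ T.card := by
    have := Finset.sum_le_sum (s := T) fun i _ => hv1 i
    simpa using this
  split_ifs with h
  · obtain ⟨hSn, hTn⟩ := h
    have hSc : (0 : ℝ) < S.card := by exact_mod_cast Finset.card_pos.2 hSn
    have hTc : (0 : ℝ) < T.card := by exact_mod_cast Finset.card_pos.2 hTn
    have hW := empW_bound S T hSn hTn ζ (fun a b => ‖a - b‖) (Mc c / γ)
      (div_nonneg (hMc0 c) hγ.le) v (by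
        intro i hi j hj
        rw [hSdef, Finset.mem_filter] at hi
        rw [hTdef, Finset.mem_filter] at hj
        simp only [hv]
        rw [hi.2, hj.2]
        refine (ramp_lip _ _ _ hγ).trans ?_
        rw [div_mul_eq_mul_div, abs_sub_comm]
        exact div_le_div_of_nonneg_right (hMc c i j (hdisj i hi.1 j hj.1)) hγ.le)
    set avT := (∑ j ∈ T, v j) / (T.card : ℝ) with havT
    set avS := (∑ j ∈ S, v j) / (S.card : ℝ) with havS
    have e1 : ∑ j ∈ T, v j = T.card * avT := by rw [havT, mul_div_cancel₀ _ hTc.ne']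
    have e2 : ∑ j ∈ S, v j = S.card * avS := by rw [havS, mul_div_cancel₀ _ hSc.ne']
    have a0 : 0 ≤ avT := div_nonneg hT0 hTc.le
    have a1 : avT ≤ 1 := by rw [havT, div_le_one hTc]; exact hT1
    rw [e1, e2]
    have b1 : ((T.card : ℝ) / u - S.card / m) * avT ≤ |(T.card : ℝ) / u - S.card / m| := by
      refine (mul_le_mul_of_nonneg_right (le_abs_self _) a0).trans ?_
      exact mul_le_of_le_one_right (abs_nonneg _) a1
    have b2 := mul_le_mul_of_nonneg_left hW (div_nonneg hSc.le hm'.le : 0 ≤ (S.card : ℝ) / m)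
    have e3 : 1 / (u : ℝ) * (T.card * avT) - 1 / (m : ℝ) * (S.card * avS)
      = ((T.card : ℝ) / u - S.card / m) * avT + (S.card : ℝ) / m * (avT - avS) := by ring
    rw [e3]
    linarith
  · rw [mul_zero, mul_zero, zero_add]
    by_cases hSn : S.Nonempty
    · have hTe : T = ∅ := by
        by_contra hT
        exact h ⟨hSn, Finset.nonempty_iff_ne_empty.2 hT⟩
      rw [hTe, Finset.sum_empty, mul_zero]
      have : 0 ≤ 1 / (m : ℝ) * ∑ i ∈ S, v i := by positivity
      exact le_trans (by linarith) (abs_nonneg _)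
    · rw [Finset.not_nonempty_iff_eq_empty] at hSn
      rw [hSn, Finset.sum_empty, mul_zero, sub_zero, Finset.card_empty]
      refine le_trans ?_ (le_abs_self _)
      have := mul_le_mul_of_nonneg_left hT1 (by positivity : 0 ≤ 1 / (u : ℝ))
      refine this.trans (le_of_eq ?_)
      simp; ring

theorem stmt1 {F D K m u : ℕ} (hm : 1 ≤ m) (hu : 1 ≤ u) (hK : 2 ≤ K)
    (x : Fin (m + u) → EuclideanSpace ℝ (Fin F)) (y : Fin (m + u) → Fin K)
    (φ : EuclideanSpace ℝ (Fin F) → EuclideanSpace ℝ (Fin D))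
    (Fcls : Set (EuclideanSpace ℝ (Fin D) → Fin K → ℝ)) (hFne : Fcls.Nonempty)
    (γ : ℝ) (hγ : 0 < γ) (δ : ℝ) (hδ0 : 0 < δ) (hδ1 : δ < 1)
    (Mc : Fin K → ℝ) (hMc0 : ∀ c, 0 ≤ Mc c)
    (hMc : ∀ c : Fin K, ∀ f ∈ Fcls, ∀ i j : Fin (m + u), i ≠ j →
      |margin f (φ (x i)) c - margin f (φ (x j)) c| ≤ Mc c * ‖φ (x i) - φ (x j)‖) :
    1 - δ ≤
      ((Finset.univ.filter (fun π : Equiv.Perm (Fin (m + u)) =>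
          ∀ f ∈ Fcls,
            testErr (fun i => φ (x i)) y f π - trainErr (fun i => φ (x i)) y f γ π ≤
              (∑ c : Fin K, (Mc c / γ) *
                pexp (fun π' =>
                  ((((trainIdx m u π').filter (fun i => y i = c)).card : ℝ) / (m : ℝ)) *
                    Wclass (fun i => φ (x i)) y c π'))
              + pexp (fun π' => ∑ c : Fin K,
                  |(((testIdx m u π').filter (fun i => y i = c)).card : ℝ) / (u : ℝ)
                    - (((trainIdx m u π').filter (fun i => y i = c)).card : ℝ) / (m : ℝ)|)
              + Real.sqrt ((m : ℝ) * (u : ℝ) * (1 / (m : ℝ) + 1 / (u : ℝ)) ^ 2 /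
                    (2 * ((m : ℝ) + (u : ℝ) - 1 / 2)) *
                  (1 - 1 / (2 * (max m u : ℝ)))⁻¹ * Real.log (1 / δ)))).card : ℝ) /
        (Fintype.card (Equiv.Perm (Fin (m + u))) : ℝ) := by
  have : Nonempty Fcls := hFne.to_subtype
  have hmain := conc (ι := Fcls) m u hm hu
    (fun f i => if margin f.1 (φ (x i)) (y i) ≤ 0 then (1 : ℝ) else 0)
    (fun f i => if margin f.1 (φ (x i)) (y i) ≤ γ then (1 : ℝ) else 0)
    (fun f i => by split_ifs <;> norm_num)
    (fun f i => by split_ifs <;> norm_num)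
    (fun f i => by split_ifs <;> norm_num)
    (fun f i => by split_ifs <;> norm_num)
    _ (fun f π => det_bound hm hu (fun i => φ (x i)) y f.1 γ hγ Mc hMc0
      (fun c => hMc c f.1 f.2) π) δ hδ0 hδ1
  refine hmain.trans (le_of_eq ?_)
  congr 3
  refine Finset.filter_congr fun π _ => ?_
  have hlin : ∀ (A : Fin K → Equiv.Perm (Fin (m + u)) → ℝ) (w : Fin K → ℝ)
      (C : Equiv.Perm (Fin (m + u)) → ℝ),
      pexp (fun π => ∑ c, w c * A c π + C π) = ∑ c, w c * pexp (A c) + pexp C := by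
    intro A w C
    simp only [pexp]
    rw [Finset.sum_add_distrib, add_div, Finset.sum_comm, Finset.sum_div]
    congr 1
    refine Finset.sum_congr rfl fun c _ => ?_
    rw [← Finset.mul_sum, mul_div_assoc]
  rw [hlin (fun c π' => ((((trainIdx m u π').filter (fun i => y i = c)).card : ℝ) / (m : ℝ)) *
                    Wclass (fun i => φ (x i)) y c π') (fun c => Mc c / γ)]
  exact ⟨fun h f hf => h ⟨f, hf⟩, fun h f => h f.1 f.2⟩
end

section
/- Let A ∈ {0,1}^{N×N} be a symmetric adjacency matrix, Ã := A + I, d̃_i := Σ_j Ã_{ij} (so d̃_i ≥ 1 for all i), D̃ := diag(d̃_1,…,d̃_N), Â := D̃^{−1/2} Ã D̃^{−1/2}, and u1 ∈ ℝ^N with entries (u1)_i = √d̃_i. Let ρ_⊥ ≥ 0 be any constant such that ‖Â h‖ ≤ ρ_⊥·‖h‖ for every h ∈ ℝ^N with ⟨u1, h⟩ = 0 (for instance, the largest absolute value among the eigenvalues of the symmetric matrix Â associated with eigenvectors orthogonal to u1). Let X ∈ ℝ^{N×F} be a feature matrix and define, for each ℓ ∈ ℕ and node i, the depth-ℓ SGC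 embedding z_i^{(ℓ)} := (Â^ℓ X)_{i·} ∈ ℝ^F and the degree statistic d_i := √d̃_i ∈ ℝ. Then there exist constants C1 ≥ 0 and C2 ≥ 0, depending only on X and Â, such that for every pair of nonempty subsets S, T ⊆ {1,…,N} and every ℓ ∈ ℕ: W({z_i^{(ℓ)}}_{i∈S}, {z_j^{(ℓ)}}_{j∈T}) ≤ C1·W({d_i}_{i∈S}, {d_j}_{j∈T}) + C2·ρ_⊥^ℓ, where the first W is the empirical 1-Wasserstein distance in ℝ^F and the second is the empirical 1-Wasserstein distance in ℝ (with absolute-value cost). -/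
open scoped BigOperators

/-- Euclidean norm of a vector. -/
noncomputable def euclNorm {n : ℕ} (v : Fin n → ℝ) : ℝ := Real.sqrt (∑ i, (v i) ^ 2)

theorem euclNorm_nonneg {n : ℕ} (v : Fin n → ℝ) : 0 ≤ euclNorm v := Real.sqrt_nonneg _

theorem abs_le_euclNorm {n : ℕ} (v : Fin n → ℝ) (i : Fin n) : |v i| ≤ euclNorm v := by
  unfold euclNorm
  apply Real.abs_le_sqrt
  exact Finset.single_le_sum (f := fun i => v i ^ 2) (fun j _ => sq_nonneg _) (Finset.mem_univ i)

theorem euclNorm_le_sum {n : ℕ} (v : Fin n → ℝ) : euclNorm v ≤ ∑ i, |v i| := by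
  unfold euclNorm
  rw [Real.sqrt_le_left (Finset.sum_nonneg fun i _ => abs_nonneg _)]
  have := Finset.sum_sq_le_sq_sum_of_nonneg (s := Finset.univ) (f := fun i => |v i|)
    (fun i _ => abs_nonneg _)
  simpa using this

theorem empW_le {ι α β : Type*} (S T : Finset ι) (hS : S.Nonempty) (hT : T.Nonempty)
    (z : ι → α) (c : α → α → ℝ) (w : ι → β) (d : β → β → ℝ)
    (hc : ∀ a b, 0 ≤ c a b) (C E : ℝ) (hC : 0 ≤ C)
    (h : ∀ i j, c (z i) (z j) ≤ C * d (w i) (w j) + E) :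
    empW S T z c ≤ C * empW S T w d + E := by
  have hSc : (S.card : ℝ) ≠ 0 := by exact_mod_cast hS.card_pos.ne'
  have hTc : (T.card : ℝ) ≠ 0 := by exact_mod_cast hT.card_pos.ne'
  have key : ∀ Γ : ι → ι → ℝ, (∀ i ∈ S, ∀ j ∈ T, 0 ≤ Γ i j) →
      (∀ i ∈ S, ∑ j ∈ T, Γ i j = 1 / (S.card : ℝ)) →
      (∀ j ∈ T, ∑ i ∈ S, Γ i j = 1 / (T.card : ℝ)) →
      empW S T z c ≤ C * (∑ i ∈ S, ∑ j ∈ T, Γ i j * d (w i) (w j)) + E := by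
    intro Γ h0 h1 h2
    have htot : ∑ i ∈ S, ∑ j ∈ T, Γ i j = 1 := by
      rw [Finset.sum_congr rfl h1]
      simp [hSc]
    calc empW S T z c ≤ ∑ i ∈ S, ∑ j ∈ T, Γ i j * c (z i) (z j) := by
          apply csInf_le
          · refine ⟨0, ?_⟩
            rintro x ⟨G, g0, -, -, rfl⟩
            exact Finset.sum_nonneg fun i hi => Finset.sum_nonneg fun j hj =>
              mul_nonneg (g0 i hi j hj) (hc _ _)
          · exact ⟨Γ, h0, h1, h2, rfl⟩
      _ ≤ ∑ i ∈ S, ∑ j ∈ T, (C * (Γ i j * d (w i) (w j)) + Γ i j * E) := by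
          refine Finset.sum_le_sum fun i hi => Finset.sum_le_sum fun j hj => ?_
          have := mul_le_mul_of_nonneg_left (h i j) (h0 i hi j hj)
          linarith
      _ = C * (∑ i ∈ S, ∑ j ∈ T, Γ i j * d (w i) (w j))
            + (∑ i ∈ S, ∑ j ∈ T, Γ i j) * E := by
          simp only [Finset.sum_add_distrib, Finset.mul_sum, Finset.sum_mul]
      _ = _ := by rw [htot, one_mul]
  have p0 : ∀ i ∈ S, ∀ j ∈ T, (0 : ℝ) ≤ (fun _ _ : ι => 1 / ((S.card : ℝ) * T.card)) i j :=
    fun i _ j _ => by positivity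
  have p1 : ∀ i ∈ S, ∑ j ∈ T, (fun _ _ : ι => 1 / ((S.card : ℝ) * T.card)) i j
      = 1 / (S.card : ℝ) := by
    intro i _
    simp only [Finset.sum_const, nsmul_eq_mul]
    field_simp
  have p2 : ∀ j ∈ T, ∑ i ∈ S, (fun _ _ : ι => 1 / ((S.card : ℝ) * T.card)) i j
      = 1 / (T.card : ℝ) := by
    intro i _
    simp only [Finset.sum_const, nsmul_eq_mul]
    field_simp
  rcases hC.eq_or_lt with hC0 | hCpos
  · subst hC0
    simpa using key _ p0 p1 p2
  · have : (empW S T z c - E) / C ≤ empW S T w d := by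
      apply le_csInf
      · exact ⟨_, _, p0, p1, p2, rfl⟩
      · rintro x ⟨G, g0, g1, g2, rfl⟩
        rw [div_le_iff₀ hCpos]
        linarith [key G g0 g1 g2]
    rw [div_le_iff₀ hCpos] at this
    linarith

theorem stmt2 {N F : ℕ} (A : Matrix (Fin N) (Fin N) ℝ)
    (hA01 : ∀ i j, A i j = 0 ∨ A i j = 1) (hsym : A.IsSymm)
    (Atil : Matrix (Fin N) (Fin N) ℝ) (hAtil : Atil = A + 1)
    (dtil : Fin N → ℝ) (hdtil : ∀ i, dtil i = ∑ j, Atil i j)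
    (Ahat : Matrix (Fin N) (Fin N) ℝ)
    (hAhat : Ahat =
      Matrix.diagonal (fun i => 1 / Real.sqrt (dtil i)) * Atil *
        Matrix.diagonal (fun i => 1 / Real.sqrt (dtil i)))
    (u1 : Fin N → ℝ) (hu1 : ∀ i, u1 i = Real.sqrt (dtil i))
    (ρ : ℝ) (hρ0 : 0 ≤ ρ)
    (hρ : ∀ h : Fin N → ℝ, (∑ i, u1 i * h i) = 0 →
      euclNorm (Ahat.mulVec h) ≤ ρ * euclNorm h)
    (X : Matrix (Fin N) (Fin F) ℝ) :
    ∃ C1 C2 : ℝ, 0 ≤ C1 ∧ 0 ≤ C2 ∧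
      ∀ S T : Finset (Fin N), S.Nonempty → T.Nonempty → ∀ ℓ : ℕ,
        empW S T (fun i => (Ahat ^ ℓ * X) i) (fun a b => euclNorm (a - b))
          ≤ C1 * empW S T (fun i => Real.sqrt (dtil i)) (fun a b => |a - b|)
            + C2 * ρ ^ ℓ := by
  have hdpos : ∀ i, 0 < dtil i := by
    intro i
    rw [hdtil, hAtil]
    have h0 : ∀ i j, 0 ≤ A i j := fun i j => by rcases hA01 i j with h | h <;> simp [h]
    have hone : ∑ j, (1 : Matrix (Fin N) (Fin N) ℝ) i j = 1 := by
      simp [Matrix.one_apply]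
    simp only [Matrix.add_apply, Finset.sum_add_distrib, hone]
    have := Finset.sum_nonneg (s := Finset.univ) fun j _ => h0 i j
    linarith
  have hspos : ∀ i, 0 < Real.sqrt (dtil i) := fun i => Real.sqrt_pos.2 (hdpos i)
  have hent : ∀ i j, Ahat i j = 1 / Real.sqrt (dtil i) * Atil i j * (1 / Real.sqrt (dtil j)) := by
    intro i j
    rw [hAhat, Matrix.mul_diagonal, Matrix.diagonal_mul]
  have hAsym : ∀ i j, Ahat i j = Ahat j i := by
    intro i j
    have : Atil i j = Atil j i := by
      rw [hAtil, Matrix.add_apply, Matrix.add_apply, hsym.apply i j, Matrix.one_apply,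
        Matrix.one_apply]
      simp [eq_comm]
    rw [hent, hent, this]
    ring
  have heig : Ahat.mulVec u1 = u1 := by
    funext i
    have hterm : ∀ j, Ahat i j * u1 j = 1 / Real.sqrt (dtil i) * Atil i j := by
      intro j
      rw [hent, hu1]
      have := (hspos j).ne'
      field_simp
    simp only [Matrix.mulVec, dotProduct, hterm]
    rw [← Finset.mul_sum, ← hdtil, hu1]
    have := (hspos i).ne'
    field_simp
    exact (Real.sq_sqrt (hdpos i).le).symm
  have horth : ∀ h : Fin N → ℝ, (∑ i, u1 i * h i) = 0 →
      (∑ i, u1 i * (Ahat.mulVec h) i) = 0 := by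
    intro h hh
    have : ∑ i, u1 i * (Ahat.mulVec h) i = ∑ j, (Ahat.mulVec u1) j * h j := by
      simp only [Matrix.mulVec, dotProduct, Finset.mul_sum, Finset.sum_mul]
      rw [Finset.sum_comm]
      refine Finset.sum_congr rfl fun j _ => Finset.sum_congr rfl fun i _ => ?_
      rw [hAsym i j]
      ring
    rw [this, heig, hh]
  have hpow : ∀ (h : Fin N → ℝ), (∑ i, u1 i * h i) = 0 → ∀ ℓ : ℕ,
      (∑ i, u1 i * ((Ahat ^ ℓ).mulVec h) i) = 0 ∧
      euclNorm ((Ahat ^ ℓ).mulVec h) ≤ ρ ^ ℓ * euclNorm h := by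
    intro h hh ℓ
    induction ℓ with
    | zero => simp [hh]
    | succ k ih =>
      rw [pow_succ' Ahat, ← Matrix.mulVec_mulVec]
      refine ⟨horth _ ih.1, (hρ _ ih.1).trans ?_⟩
      rw [pow_succ', mul_assoc]
      exact mul_le_mul_of_nonneg_left ih.2 hρ0
  have hpowu : ∀ ℓ : ℕ, (Ahat ^ ℓ).mulVec u1 = u1 := by
    intro ℓ
    induction ℓ with
    | zero => simp
    | succ k ih => rw [pow_succ' Ahat, ← Matrix.mulVec_mulVec, ih, heig]
  obtain ⟨a, ha⟩ : ∃ a : Fin F → ℝ, ∀ f, ∑ i, u1 i * (X i f - a f * u1 i) = 0 := by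
    refine ⟨fun f => (∑ i, u1 i * X i f) / ∑ i, u1 i * u1 i, fun f => ?_⟩
    rcases isEmpty_or_nonempty (Fin N) with hN | hN
    · simp
    have hq : 0 < ∑ i, u1 i * u1 i :=
      Finset.sum_pos (fun i _ => by rw [hu1]; exact mul_pos (hspos i) (hspos i))
        Finset.univ_nonempty
    have : ∀ b : ℝ, ∑ i, u1 i * (X i f - b * u1 i)
        = ∑ i, u1 i * X i f - b * ∑ i, u1 i * u1 i := by
      intro b
      rw [Finset.mul_sum, ← Finset.sum_sub_distrib]
      exact Finset.sum_congr rfl fun i _ => by ring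
    rw [this, div_mul_cancel₀ _ hq.ne', sub_self]
  have hz : ∀ (ℓ : ℕ) i f, (Ahat ^ ℓ * X) i f
      = a f * u1 i + ((Ahat ^ ℓ).mulVec (fun i => X i f - a f * u1 i)) i := by
    intro ℓ i f
    have h1 : (fun i => X i f - a f * u1 i) = (fun i => X i f) - a f • u1 := by
      funext i; simp
    rw [h1, Matrix.mulVec_sub, Matrix.mulVec_smul, hpowu]
    simp [Matrix.mul_apply, Matrix.mulVec, dotProduct]
  refine ⟨∑ f, |a f|, ∑ f, 2 * euclNorm (fun i => X i f - a f * u1 i),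
    Finset.sum_nonneg fun f _ => abs_nonneg _,
    Finset.sum_nonneg fun f _ => mul_nonneg zero_le_two (euclNorm_nonneg _), ?_⟩
  intro S T hS hT ℓ
  refine empW_le S T hS hT _ _ _ _ (fun _ _ => euclNorm_nonneg _) _ _
    (Finset.sum_nonneg fun f _ => abs_nonneg _) fun i j => ?_
  refine (euclNorm_le_sum _).trans ?_
  rw [Finset.sum_mul, Finset.sum_mul, ← Finset.sum_add_distrib]
  refine Finset.sum_le_sum fun f _ => ?_
  have hb := (hpow _ (ha f) ℓ).2
  have hi := (abs_le_euclNorm _ i).trans hb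
  have hj := (abs_le_euclNorm _ j).trans hb
  rw [Pi.sub_apply, hz, hz, ← hu1, ← hu1, ← abs_mul]
  set p := ((Ahat ^ ℓ).mulVec (fun i => X i f - a f * u1 i)) i
  set q := ((Ahat ^ ℓ).mulVec (fun i => X i f - a f * u1 i)) j
  have e : a f * u1 i + p - (a f * u1 j + q) = a f * (u1 i - u1 j) + (p - q) := by ring
  rw [e]
  have t1 := abs_add_le (a f * (u1 i - u1 j)) (p - q)
  have t2 := abs_sub p q
  linarith
end

section
/- Let m, u ≥ 1, N = m + u, and let {1,…,N} be partitioned into disjoint index sets I_train of size m and I_test of size u. Let y_1,…,y_N ∈ {1,…,K} be labels and let ℓ_1,…,ℓ_N be real numbers with 0 ≤ ℓ_i ≤ 1 for all i. For each class c ∈ {1,…,K} let m_c := |{i ∈ I_train : y_i = c}| and u_c := |{i ∈ I_test : y_i = c}|, and define avgTrain_c := (1/m_c)·Σ_{i∈I_train, y_i=c} ℓ_i if m_c > 0 and avgTrain_c := 0 otherwise, and similarly avgTest_c := (1/u_c)·Σ_{i∈I_test, y_i=c} ℓ_i if u_c > 0 and avgTest_c := 0 otherwise. Then (1/u)·Σ_{i∈I_test}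 ℓ_i − (1/m)·Σ_{i∈I_train} ℓ_i ≤ Σ_{c=1}^K (m_c/m)·(avgTest_c − avgTrain_c) + Σ_{c=1}^K | u_c/u − m_c/m |. -/
open scoped BigOperators

attribute [local instance] Classical.propDecidable

theorem aux_class (a b : ℕ) (m u T S : ℝ)
    (hT0 : 0 ≤ T) (hTa : T ≤ a) (hS0 : 0 ≤ S) (hSb : S ≤ b) :
    (1 / u) * T - (1 / m) * S ≤
      ((b : ℝ) / m) * ((if a ≠ 0 then (1 / (a : ℝ)) * T else 0)
        - (if b ≠ 0 then (1 / (b : ℝ)) * S else 0))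
      + |(a : ℝ) / u - (b : ℝ) / m| := by
  obtain ⟨t, ht, ht0, ht1, hT⟩ : ∃ t : ℝ, (if a ≠ 0 then (1 / (a : ℝ)) * T else 0) = t ∧
      0 ≤ t ∧ t ≤ 1 ∧ T = a * t := by
    refine ⟨_, rfl, ?_⟩
    by_cases h : a = 0
    · subst h
      simp at hTa ⊢
      linarith
    · have ha : (0 : ℝ) < a := by exact_mod_cast Nat.pos_of_ne_zero h
      rw [if_pos h]
      refine ⟨by positivity, ?_, by field_simp⟩
      rw [one_div, inv_mul_le_iff₀ ha]
      linarith
  obtain ⟨s, hs, hS⟩ : ∃ s : ℝ, (if b ≠ 0 then (1 / (b : ℝ)) * S else 0) = s ∧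
      S = b * s := by
    refine ⟨_, rfl, ?_⟩
    by_cases h : b = 0
    · subst h
      simp at hSb ⊢
      linarith
    · have hb : (0 : ℝ) < b := by exact_mod_cast Nat.pos_of_ne_zero h
      rw [if_pos h]
      field_simp
  rw [ht, hs, hT, hS]
  have h1 : ((a : ℝ) / u - b / m) * t ≤ |(a : ℝ) / u - b / m| := by
    calc ((a : ℝ) / u - b / m) * t ≤ |(a : ℝ) / u - b / m| * t :=
          mul_le_mul_of_nonneg_right (le_abs_self _) ht0
      _ ≤ |(a : ℝ) / u - b / m| * 1 := mul_le_mul_of_nonneg_left ht1 (abs_nonneg _)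
      _ = _ := mul_one _
  have h2 : (1 / u) * (a * t) - (1 / m) * (b * s)
      = (b : ℝ) / m * (t - s) + ((a : ℝ) / u - b / m) * t := by ring
  linarith

theorem stmt7 {K m u : ℕ} (hm : 1 ≤ m) (hu : 1 ≤ u)
    (Itrain Itest : Finset (Fin (m + u)))
    (hdisj : Disjoint Itrain Itest) (hunion : Itrain ∪ Itest = Finset.univ)
    (hctr : Itrain.card = m) (hcte : Itest.card = u)
    (y : Fin (m + u) → Fin K) (l : Fin (m + u) → ℝ)
    (hl0 : ∀ i, 0 ≤ l i) (hl1 : ∀ i, l i ≤ 1) :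
    (1 / (u : ℝ)) * ∑ i ∈ Itest, l i - (1 / (m : ℝ)) * ∑ i ∈ Itrain, l i
      ≤ (∑ c : Fin K,
          (((Itrain.filter (fun i => y i = c)).card : ℝ) / (m : ℝ)) *
            ((if (Itest.filter (fun i => y i = c)).card ≠ 0 then
                (1 / ((Itest.filter (fun i => y i = c)).card : ℝ)) *
                  ∑ i ∈ Itest.filter (fun i => y i = c), l i
              else 0)
            - (if (Itrain.filter (fun i => y i = c)).card ≠ 0 then
                (1 / ((Itrain.filter (fun i => y i = c)).card : ℝ)) *
                  ∑ i ∈ Itrain.filter (fun i => y i = c), l i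
              else 0)))
        + ∑ c : Fin K,
            |((Itest.filter (fun i => y i = c)).card : ℝ) / (u : ℝ)
              - ((Itrain.filter (fun i => y i = c)).card : ℝ) / (m : ℝ)| := by
  have hsum : ∀ I : Finset (Fin (m + u)),
      ∑ i ∈ I, l i = ∑ c : Fin K, ∑ i ∈ I.filter (fun i => y i = c), l i := by
    intro I
    rw [← Finset.sum_fiberwise I y l]
  have hle : ∀ J : Finset (Fin (m + u)), ∑ i ∈ J, l i ≤ (J.card : ℝ) := by
    intro J
    calc ∑ i ∈ J, l i ≤ ∑ _i ∈ J, (1 : ℝ) := Finset.sum_le_sum fun i _ => hl1 i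
      _ = _ := by simp
  have h0 : ∀ J : Finset (Fin (m + u)), 0 ≤ ∑ i ∈ J, l i :=
    fun J => Finset.sum_nonneg fun i _ => hl0 i
  rw [hsum Itest, hsum Itrain, Finset.mul_sum, Finset.mul_sum, ← Finset.sum_sub_distrib,
    ← Finset.sum_add_distrib]
  refine Finset.sum_le_sum fun c _ => ?_
  convert aux_class _ _ (m : ℝ) (u : ℝ) _ _ (h0 _) (hle _) (h0 _) (hle _)
end

section
/- Let Â be a real n×n matrix and u ∈ ℝ^n a vector with nonnegative entries such that Â·u = u. Let a ∈ ℝ^{F₁} and let W be a real F₁×F₂ matrix. Then ReLU(Â·(u·aᵀ)·W) = u·(ReLU(Wᵀ·a))ᵀ; that is, for all indices i ∈ {1,…,n} and j ∈ {1,…,F₂}, the (i,j) entry of ReLU(Â·(u·aᵀ)·W) equals u_i·max(0, (Wᵀ·a)_j). In particular, the result is again a rank-at-most-one matrix whose columns all lie in span{u}. -/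
open scoped BigOperators

theorem stmt13 {n F1 F2 : ℕ} (Ahat : Matrix (Fin n) (Fin n) ℝ)
    (u : Fin n → ℝ) (hu : ∀ i, 0 ≤ u i) (hAu : Ahat.mulVec u = u)
    (a : Fin F1 → ℝ) (W : Matrix (Fin F1) (Fin F2) ℝ) :
    (Ahat * Matrix.vecMulVec u a * W).map (fun t => max t 0)
      = Matrix.vecMulVec u (fun j => max (W.transpose.mulVec a j) 0) := by
  rw [Matrix.mul_vecMulVec, hAu, Matrix.vecMulVec_mul]
  ext i j
  simp only [Matrix.map_apply, Matrix.vecMulVec_apply, Matrix.mulVec_transpose]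
  rw [mul_max_of_nonneg _ _ (hu i), mul_zero]
end

section
/- Let Â be a symmetric real n×n matrix and let u ∈ ℝ^n be nonzero with nonnegative entries and Â·u = u. Suppose ρ ≥ 0 satisfies ‖Â·h‖ ≤ ρ·‖h‖ for every h ∈ ℝ^n with ⟨u, h⟩ = 0, and let P := I − u·uᵀ/‖u‖². Let β ≥ 0 and let W^{(0)}, W^{(1)}, … be real matrices (of any compatible dimensions) with spectral norm ‖W^{(t)}‖₂ ≤ β for every t. Let X be a real n×F₀ matrix and define X^{(0)} := X and X^{(t+1)} := ReLU(Â·X^{(t)}·W^{(t)}) for all t ≥ 0, where ReLU is applied entrywise. Then for every ℓ ∈ ℕ: ‖P·X^{(ℓ)}‖_F ≤ (β·ρ)^ℓ·‖P·X‖_F. -/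
open scoped BigOperators

/-- Frobenius norm of a real matrix. -/
noncomputable def frobNorm {n F : ℕ} (M : Matrix (Fin n) (Fin F) ℝ) : ℝ :=
  Real.sqrt (∑ i, ∑ j, (M i j) ^ 2)

/-- GCN iterates `X^{(0)} = X`, `X^{(t+1)} = ReLU(Â · X^{(t)} · W^{(t)})`. -/
noncomputable def gcnIter {n : ℕ} (Fdim : ℕ → ℕ) (Ahat : Matrix (Fin n) (Fin n) ℝ)
    (W : ∀ t : ℕ, Matrix (Fin (Fdim t)) (Fin (Fdim (t + 1))) ℝ)
    (X : Matrix (Fin n) (Fin (Fdim 0)) ℝ) : ∀ t : ℕ, Matrix (Fin n) (Fin (Fdim t)) ℝ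
  | 0 => X
  | t + 1 => (Ahat * gcnIter Fdim Ahat W X t * W t).map (fun a => max a 0)

/-- squared form of a Euclidean norm bound -/
lemma sq_of_euclNorm_le {m n : ℕ} {v : Fin m → ℝ} {w : Fin n → ℝ} {c : ℝ}
    (h : euclNorm v ≤ c * euclNorm w) : ∑ i, (v i) ^ 2 ≤ c ^ 2 * ∑ i, (w i) ^ 2 := by
  unfold euclNorm at h
  have h1 := pow_le_pow_left₀ (Real.sqrt_nonneg _) h 2
  rwa [mul_pow, Real.sq_sqrt (Finset.sum_nonneg fun i _ => sq_nonneg _),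
    Real.sq_sqrt (Finset.sum_nonneg fun i _ => sq_nonneg _)] at h1

lemma transpose_bound {m n : ℕ} (W : Matrix (Fin m) (Fin n) ℝ) (β : ℝ)
    (hW : ∀ v : Fin n → ℝ, ∑ i, (W.mulVec v i) ^ 2 ≤ β ^ 2 * ∑ i, (v i) ^ 2)
    (x : Fin m → ℝ) : ∑ j, (Matrix.vecMul x W j) ^ 2 ≤ β ^ 2 * ∑ i, (x i) ^ 2 := by
  set y := Matrix.vecMul x W with hy
  have h1 := hW y
  have h2 : ∑ j, (y j) ^ 2 = ∑ i, x i * W.mulVec y i := by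
    have := Matrix.dotProduct_mulVec x W y
    rw [← hy] at this
    simp only [dotProduct] at this
    rw [this]
    exact Finset.sum_congr rfl fun j _ => by ring
  have h3 := Finset.sum_mul_sq_le_sq_mul_sq Finset.univ x (fun i => W.mulVec y i)
  rw [← h2] at h3
  have hx : 0 ≤ ∑ i, (x i) ^ 2 := Finset.sum_nonneg fun i _ => sq_nonneg _
  have hyn : 0 ≤ ∑ j, (y j) ^ 2 := Finset.sum_nonneg fun i _ => sq_nonneg _
  rcases hyn.eq_or_lt with h0 | h0
  · rw [← h0]; positivity
  · have h4 := mul_le_mul_of_nonneg_left h1 hx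
    refine le_of_mul_le_mul_right ?_ h0
    nlinarith

lemma relu_proj {n : ℕ} (u : Fin n → ℝ) (hu0 : ∀ i, 0 ≤ u i) (hS : 0 < ∑ i, (u i) ^ 2)
    (x : Fin n → ℝ) :
    ∑ i, (max (x i) 0 - (∑ k, (u k) ^ 2)⁻¹ * (u i * ∑ k, u k * max (x k) 0)) ^ 2 ≤
      ∑ i, (x i - (∑ k, (u k) ^ 2)⁻¹ * (u i * ∑ k, u k * x k)) ^ 2 := by
  set S := ∑ k, (u k) ^ 2 with hSd
  set c := S⁻¹ * ∑ k, u k * x k with hc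
  have key : ∀ (y : Fin n → ℝ) (d : ℝ), ∑ i, (y i - d * u i) ^ 2 =
      ∑ i, (y i) ^ 2 - 2 * d * (∑ i, u i * y i) + d ^ 2 * S := by
    intro y d
    rw [hSd, Finset.mul_sum, Finset.mul_sum, ← Finset.sum_sub_distrib, ← Finset.sum_add_distrib]
    exact Finset.sum_congr rfl fun i _ => by ring
  have hmin : ∀ (y : Fin n → ℝ) (d : ℝ),
      ∑ i, (y i - (S⁻¹ * ∑ k, u k * y k) * u i) ^ 2 ≤ ∑ i, (y i - d * u i) ^ 2 := by
    intro y d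
    rw [key, key]
    set D := ∑ k, u k * y k
    have : D = (S⁻¹ * D) * S := by field_simp
    set e := S⁻¹ * D
    rw [this]
    nlinarith [mul_nonneg hS.le (sq_nonneg (d - e))]
  have e1 : ∀ y : Fin n → ℝ, ∑ i, (y i - S⁻¹ * (u i * ∑ k, u k * y k)) ^ 2 =
      ∑ i, (y i - (S⁻¹ * ∑ k, u k * y k) * u i) ^ 2 := fun y =>
    Finset.sum_congr rfl fun i _ => by ring
  rw [e1 x, e1 (fun i => max (x i) 0)]
  refine (hmin (fun i => max (x i) 0) (max c 0)).trans ?_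
  refine Finset.sum_le_sum fun i _ => ?_
  have h1 : max c 0 * u i = max (c * u i) 0 := by
    rw [max_mul_of_nonneg _ _ (hu0 i), zero_mul]
  show (max (x i) 0 - max c 0 * u i) ^ 2 ≤ _
  rw [h1]
  exact sq_le_sq.mpr (abs_max_sub_max_le_abs _ _ _)

theorem stmt14 {n : ℕ} (Ahat : Matrix (Fin n) (Fin n) ℝ) (hsym : Ahat.IsSymm)
    (u : Fin n → ℝ) (hu : u ≠ 0) (hu0 : ∀ i, 0 ≤ u i) (hAu : Ahat.mulVec u = u)
    (ρ : ℝ) (hρ0 : 0 ≤ ρ)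
    (hρ : ∀ h : Fin n → ℝ, (∑ i, u i * h i) = 0 →
      euclNorm (Ahat.mulVec h) ≤ ρ * euclNorm h)
    (P : Matrix (Fin n) (Fin n) ℝ)
    (hP : P = 1 - ((euclNorm u) ^ 2)⁻¹ • Matrix.vecMulVec u u)
    (β : ℝ) (hβ : 0 ≤ β) (Fdim : ℕ → ℕ)
    (W : ∀ t : ℕ, Matrix (Fin (Fdim t)) (Fin (Fdim (t + 1))) ℝ)
    (hW : ∀ t : ℕ, ∀ v : Fin (Fdim (t + 1)) → ℝ,
      euclNorm ((W t).mulVec v) ≤ β * euclNorm v)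
    (X : Matrix (Fin n) (Fin (Fdim 0)) ℝ) (ℓ : ℕ) :
    frobNorm (P * gcnIter Fdim Ahat W X ℓ) ≤ (β * ρ) ^ ℓ * frobNorm (P * X) := by
  have hSe : (euclNorm u) ^ 2 = ∑ i, (u i) ^ 2 :=
    Real.sq_sqrt (Finset.sum_nonneg fun i _ => sq_nonneg _)
  have hS : 0 < ∑ i, (u i) ^ 2 := by
    obtain ⟨i, hi⟩ := Function.ne_iff.mp hu
    exact Finset.sum_pos' (fun i _ => sq_nonneg _) ⟨i, Finset.mem_univ _, pow_pos
      (lt_of_le_of_ne (hu0 i) (Ne.symm hi)) 2⟩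
  rw [hSe] at hP
  have hPM : ∀ {F : ℕ} (M : Matrix (Fin n) (Fin F) ℝ) (i : Fin n) (j : Fin F), (P * M) i j =
      M i j - (∑ k, (u k) ^ 2)⁻¹ * (u i * ∑ k, u k * M k j) := by
    intro F M i j
    rw [hP, Matrix.sub_mul, Matrix.one_mul, Matrix.smul_mul, Matrix.sub_apply, Matrix.smul_apply,
      Matrix.mul_apply, smul_eq_mul]
    simp only [Matrix.vecMulVec_apply, mul_assoc, Finset.mul_sum]
  have hcomm : P * Ahat = Ahat * P := by
    have h1 : Matrix.vecMul u Ahat = u := by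
      rw [← hsym.eq, Matrix.vecMul_transpose]; exact hAu
    rw [hP, Matrix.sub_mul, Matrix.mul_sub, Matrix.one_mul, Matrix.mul_one, Matrix.smul_mul,
      Matrix.mul_smul, Matrix.vecMulVec_mul, Matrix.mul_vecMulVec, h1, hAu]
  have hperp : ∀ {F : ℕ} (M : Matrix (Fin n) (Fin F) ℝ) (j : Fin F),
      ∑ i, u i * (P * M) i j = 0 := by
    intro F M j
    simp only [hPM, mul_sub, Finset.sum_sub_distrib]
    have : ∑ i, u i * ((∑ k, (u k) ^ 2)⁻¹ * (u i * ∑ k, u k * M k j)) =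
        (∑ i, (u i) ^ 2) * ((∑ k, (u k) ^ 2)⁻¹ * ∑ k, u k * M k j) := by
      rw [Finset.sum_mul]
      exact Finset.sum_congr rfl fun i _ => by ring
    rw [this, ← mul_assoc, mul_inv_cancel₀ hS.ne', one_mul, sub_self]
  have step : ∀ t, frobNorm (P * gcnIter Fdim Ahat W X (t + 1)) ≤
      (β * ρ) * frobNorm (P * gcnIter Fdim Ahat W X t) := by
    intro t
    set Y := gcnIter Fdim Ahat W X t with hY
    have hY1 : gcnIter Fdim Ahat W X (t + 1) = (Ahat * Y * W t).map (fun a => max a 0) := rfl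
    rw [hY1]
    unfold frobNorm
    rw [← Real.sqrt_sq (mul_nonneg hβ hρ0), ← Real.sqrt_mul (sq_nonneg _)]
    apply Real.sqrt_le_sqrt
    have a1 : ∑ i, ∑ j, ((P * (Ahat * Y * W t).map (fun a => max a 0)) i j) ^ 2 ≤
        ∑ i, ∑ j, ((P * (Ahat * Y * W t)) i j) ^ 2 := by
      rw [Finset.sum_comm, Finset.sum_comm (f := fun i j => ((P * (Ahat * Y * W t)) i j) ^ 2)]
      refine Finset.sum_le_sum fun j _ => ?_
      simp only [hPM, Matrix.map_apply]
      exact relu_proj u hu0 hS (fun i => (Ahat * Y * W t) i j)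
    have a2 : P * (Ahat * Y * W t) = Ahat * (P * Y) * W t := by
      rw [← Matrix.mul_assoc, ← Matrix.mul_assoc, hcomm, Matrix.mul_assoc Ahat P Y]
    have a3 : ∑ i, ∑ j, ((Ahat * (P * Y) * W t) i j) ^ 2 ≤
        β ^ 2 * ∑ i, ∑ j, ((Ahat * (P * Y)) i j) ^ 2 := by
      rw [Finset.mul_sum]
      refine Finset.sum_le_sum fun i _ => ?_
      exact transpose_bound (W t) β (fun v => sq_of_euclNorm_le (hW t v))
        (fun j => (Ahat * (P * Y)) i j)
    have a4 : ∑ i, ∑ j, ((Ahat * (P * Y)) i j) ^ 2 ≤ ρ ^ 2 * ∑ i, ∑ j, ((P * Y) i j) ^ 2 := by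
      rw [Finset.sum_comm, Finset.sum_comm (f := fun i j => ((P * Y) i j) ^ 2), Finset.mul_sum]
      refine Finset.sum_le_sum fun j _ => ?_
      exact sq_of_euclNorm_le (hρ (fun i => (P * Y) i j) (hperp Y j))
    rw [a2] at a1
    refine a1.trans (a3.trans ?_)
    rw [mul_pow, mul_assoc]
    exact mul_le_mul_of_nonneg_left a4 (sq_nonneg _)
  induction ℓ with
  | zero => simp [gcnIter]
  | succ t ih =>
    refine (step t).trans ?_
    rw [pow_succ', mul_assoc (β * ρ) ((β * ρ) ^ t)]
    exact mul_le_mul_of_nonneg_left ih (mul_nonneg hβ hρ0)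
end
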